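/- arXiv:2005.08878 — 2 statements merged into one kernel-verified Lean document; each statement's English description precedes it below -/
import Mathlib

section
/- Let K be an algebraic function field over a field k, let L be an arbitrary field extension of k, let p be a minimal prime ideal of the tensor product K ⊗_k L, and let K' be the fraction field of the integral domain (K ⊗_k L)/p, regarded as an algebraic function field over L via the natural map L → K'. Then cvg_k(K) = cvg_L(K'). -/
universe u v

/-- `K` is an algebraic function field over `k`, i.e. a finitely generated field extension. -/
def IsAlgFunctionField (k : Type u) (K : Type v) [Field k] [Field K] [Algebra k K] : Prop :=
  (⊤ : IntermediateField k K).FG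

/-- There is a covering diagram for `K/k` of degree `e`: algebraic function fields `K_B`, `K_C`
over `k`, a `k`-algebra embedding `K ↪ K_C` which is module-finite, and a `k`-algebra
embedding `K_B(t) ↪ K_C` with `[K_C : K_B(t)] = e`. -/
def HasCvgDiagram (k : Type u) (K : Type v) [Field k] [Field K] [Algebra k K] (e : ℕ) : Prop :=
  ∃ (K_B K_C : Type (max u v)) (_ : Field K_B) (_ : Field K_C)
    (_ : Algebra k K_B) (_ : Algebra k K_C),
    IsAlgFunctionField k K_B ∧ IsAlgFunctionField k K_C ∧
    ∃ (f : K →ₐ[k] K_C) (π : RatFunc K_B →ₐ[k] K_C),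
      f.toRingHom.Finite ∧
      (letI := π.toRingHom.toAlgebra
       Module.finrank (RatFunc K_B) K_C = e)

/-- A covering diagram with `K_C/K` moreover separable. -/
def HasSepCvgDiagram (k : Type u) (K : Type v) [Field k] [Field K] [Algebra k K] (e : ℕ) :
    Prop :=
  ∃ (K_B K_C : Type (max u v)) (_ : Field K_B) (_ : Field K_C)
    (_ : Algebra k K_B) (_ : Algebra k K_C),
    IsAlgFunctionField k K_B ∧ IsAlgFunctionField k K_C ∧
    ∃ (f : K →ₐ[k] K_C) (π : RatFunc K_B →ₐ[k] K_C),
      f.toRingHom.Finite ∧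
      (letI := f.toRingHom.toAlgebra
       Algebra.IsSeparable K K_C) ∧
      (letI := π.toRingHom.toAlgebra
       Module.finrank (RatFunc K_B) K_C = e)

/-- The covering gonality of `K` over `k`. -/
noncomputable def cvg (k : Type u) (K : Type v) [Field k] [Field K] [Algebra k K] : ℕ :=
  sInf {e : ℕ | 0 < e ∧ HasCvgDiagram k K e}

/-- The separable covering gonality of `K` over `k`. -/
noncomputable def scvg (k : Type u) (K : Type v) [Field k] [Field K] [Algebra k K] : ℕ :=
  sInf {e : ℕ | 0 < e ∧ HasSepCvgDiagram k K e}

set_option linter.style.haveILetI false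
set_option linter.unusedSectionVars false
set_option linter.unnecessarySimpa false

section place
variable {M Ω : Type*} [Field M] [Field Ω] [IsAlgClosed Ω]

/-- A place of `M` with values in `Ω`. -/
structure Plc (M Ω : Type*) [Field M] [Field Ω] where
  V : ValuationSubring M
  ψ : V →+* Ω
  loc : ∀ z : V, ψ z ≠ 0 → (z : M)⁻¹ ∈ V

theorem zorn_graph (G₀ : Subring (M × Ω)) (h₀ : ∀ b, ((0 : M), b) ∈ G₀ → b = 0) :
    ∃ G : Subring (M × Ω), G₀ ≤ G ∧ (∀ b, ((0 : M), b) ∈ G → b = 0) ∧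
      ∀ G' : Subring (M × Ω), G ≤ G' → (∀ b, ((0 : M), b) ∈ G' → b = 0) → G' ≤ G := by
  obtain ⟨G, hG0, hG⟩ := zorn_le_nonempty₀ {G : Subring (M × Ω) | ∀ b, ((0 : M), b) ∈ G → b = 0}
    (by
      intro c hc hch y hy
      have hne : Nonempty c := ⟨⟨y, hy⟩⟩
      have hdir : Directed (· ≤ ·) (fun i : c => (i : Subring (M × Ω))) := hch.directed
      refine ⟨⨆ i : c, (i : Subring (M × Ω)), ?_, fun z hz => le_iSup (fun i : c => (i : Subring (M × Ω))) ⟨z, hz⟩⟩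
      intro b hb
      obtain ⟨i, hi⟩ := (Subring.mem_iSup_of_directed hdir).mp hb
      exact hc i.2 b hi) G₀ h₀
  exact ⟨G, hG0, hG.1, fun G' h h' => hG.2 h' h⟩

theorem ext_hom {G S : Type*} [CommRing G] [CommRing S] [Algebra G S] [Algebra.FiniteType G S]
    (sn : G →+* Ω) (hm : (RingHom.ker sn).IsMaximal)
    (hz : (RingHom.ker sn).map (algebraMap G S) ≠ ⊤) :
    ∃ χ : S →+* Ω, ∀ g, χ (algebraMap G S g) = sn g := by
  obtain ⟨n, hnmax, hn⟩ := Ideal.exists_le_maximal _ hz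
  letI : Field (G ⧸ RingHom.ker sn) := Ideal.Quotient.field _
  letI : Field (S ⧸ n) := Ideal.Quotient.field n
  have hle : RingHom.ker sn ≤ n.comap (algebraMap G S) := Ideal.map_le_iff_le_comap.mp hn
  letI : Algebra (G ⧸ RingHom.ker sn) (S ⧸ n) := (Ideal.quotientMap n (algebraMap G S) hle).toAlgebra
  letI : IsScalarTower G (G ⧸ RingHom.ker sn) (S ⧸ n) := IsScalarTower.of_algebraMap_eq (fun g => rfl)
  haveI : Algebra.FiniteType G (S ⧸ n) := inferInstance
  haveI : Algebra.FiniteType (G ⧸ RingHom.ker sn) (S ⧸ n) :=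
    Algebra.FiniteType.of_restrictScalars_finiteType G (G ⧸ RingHom.ker sn) (S ⧸ n)
  haveI : Module.Finite (G ⧸ RingHom.ker sn) (S ⧸ n) := finite_of_finite_type_of_isJacobsonRing _ _
  letI : Algebra (G ⧸ RingHom.ker sn) Ω := (Ideal.Quotient.lift _ sn (fun a ha => ha)).toAlgebra
  let χ : (S ⧸ n) →ₐ[G ⧸ RingHom.ker sn] Ω := IsAlgClosed.lift
  refine ⟨χ.toRingHom.comp (Ideal.Quotient.mk n), fun g => ?_⟩
  exact χ.commutes (Ideal.Quotient.mk _ g)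

theorem integral_of_unit_lc {G S : Type*} [CommRing G] [CommRing S] [Algebra G S]
    (p : Polynomial G) (H : IsUnit p.leadingCoeff) {z : S} (hz : Polynomial.aeval z p = 0) :
    IsIntegral G z := by
  obtain ⟨u, hu⟩ := H
  have h1 : ((u⁻¹ : Gˣ) : G) * p.leadingCoeff = 1 := by rw [← hu, Units.inv_mul]
  have h2 : Polynomial.aeval z (Polynomial.C ((u⁻¹ : Gˣ) : G) * p) = 0 := by
    rw [map_mul, hz, mul_zero]
  exact ⟨Polynomial.C ((u⁻¹ : Gˣ) : G) * p,
    Polynomial.monic_C_mul_of_mul_leadingCoeff_eq_one h1, h2⟩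

theorem exists_plc {R : Type*} [CommRing R] (i : R →+* M) (φ : R →+* Ω)
    (hi : ∀ r, i r = 0 → φ r = 0) :
    ∃ P : Plc M Ω, ∃ h : ∀ r, i r ∈ P.V, ∀ r, P.ψ ⟨i r, h r⟩ = φ r := by
  obtain ⟨G, hG0, hG1, hG2⟩ := zorn_graph (M := M) (Ω := Ω) (i.prod φ).range (by
    rintro b ⟨r, hr⟩
    have h1 : i r = 0 := congrArg Prod.fst hr
    have h2 : φ r = b := congrArg Prod.snd hr
    rw [← h2]; exact hi r h1)
  have huniq : ∀ a b b', (a, b) ∈ G → (a, b') ∈ G → b = b' := by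
    intro a b b' h h'
    have := G.sub_mem h h'
    simp only [Prod.mk_sub_mk, sub_self] at this
    exact sub_eq_zero.mp (hG1 _ this)
  -- locality
  have hloc : ∀ a b, (a, b) ∈ G → b ≠ 0 → (a⁻¹, b⁻¹) ∈ G := by
    let G' : Subring (M × Ω) :=
      { carrier := {x | ∃ s ∈ G, s.2 ≠ 0 ∧ s * x ∈ G}
        mul_mem' := by
          rintro x y ⟨s, hs, hs0, hsx⟩ ⟨t, ht, ht0, hty⟩
          refine ⟨s * t, G.mul_mem hs ht, mul_ne_zero hs0 ht0, ?_⟩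
          have := G.mul_mem hsx hty
          rwa [mul_mul_mul_comm] at this
        one_mem' := ⟨1, G.one_mem, by simp, by simpa using G.one_mem⟩
        add_mem' := by
          rintro x y ⟨s, hs, hs0, hsx⟩ ⟨t, ht, ht0, hty⟩
          refine ⟨s * t, G.mul_mem hs ht, mul_ne_zero hs0 ht0, ?_⟩
          have := G.add_mem (G.mul_mem ht hsx) (G.mul_mem hs hty)
          convert this using 1; ring
        zero_mem' := ⟨1, G.one_mem, by simp, by simpa using G.zero_mem⟩
        neg_mem' := by
          rintro x ⟨s, hs, hs0, hsx⟩
          refine ⟨s, hs, hs0, ?_⟩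
          rw [mul_neg]; exact G.neg_mem hsx }
    have hle : G ≤ G' := fun x hx => ⟨1, G.one_mem, by simp, by simpa using hx⟩
    have hG'1 : ∀ b, ((0 : M), b) ∈ G' → b = 0 := by
      rintro b ⟨⟨s, σ⟩, hs, hs0, hsx⟩
      simp only [Prod.mk_mul_mk, mul_zero] at hsx
      exact (mul_eq_zero.mp (hG1 _ hsx)).resolve_left hs0
    intro a b hab hb
    apply hG2 G' hle hG'1
    refine ⟨(a, b), hab, hb, ?_⟩
    have ha : a ≠ 0 := by rintro rfl; exact hb (hG1 _ hab)
    simp only [Prod.mk_mul_mk, mul_inv_cancel₀ ha, mul_inv_cancel₀ hb]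
    exact G.one_mem
  let ev : G →+* M := (RingHom.fst M Ω).comp G.subtype
  let sn : G →+* Ω := (RingHom.snd M Ω).comp G.subtype
  letI : Algebra G M := ev.toAlgebra
  let m : Ideal G := RingHom.ker sn
  have hunit : ∀ g : G, g ∉ m → IsUnit g := by
    rintro ⟨⟨a, b⟩, hg⟩ hgm
    have hb : b ≠ 0 := hgm
    have ha : a ≠ 0 := by rintro rfl; exact hb (hG1 _ hg)
    refine IsUnit.of_mul_eq_one ⟨(a⁻¹, b⁻¹), hloc a b hg hb⟩ ?_
    ext <;> simp [ha, hb]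
  have hmtop : m ≠ ⊤ := RingHom.ker_ne_top sn
  have hmmax : m.IsMaximal := by
    refine Ideal.isMaximal_iff.mpr ⟨(Ideal.ne_top_iff_one m).mp hmtop, ?_⟩
    intro J x _ hx hxJ
    exact (Ideal.eq_top_iff_one J).mp (Ideal.eq_top_of_isUnit_mem J hxJ (hunit x hx))
  -- extension step
  have hext : ∀ z : M, (m.map (algebraMap G (Algebra.adjoin G {z})) ≠ ⊤) → ∃ b, (z, b) ∈ G := by
    intro z hz
    let S := Algebra.adjoin G {z}
    haveI : Algebra.FiniteType G S :=
      Subalgebra.fg_iff_finiteType _ |>.mp ⟨{z}, by simp [S]⟩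
    obtain ⟨χ', hχ'⟩ := ext_hom (S := S) sn hmmax hz
    let G' : Subring (M × Ω) := (S.val.toRingHom.prod χ').range
    have h1 : G ≤ G' := by
      intro g hg
      refine ⟨algebraMap G S ⟨g, hg⟩, ?_⟩
      ext
      · rfl
      · exact hχ' ⟨g, hg⟩
    have h2 : ∀ b, ((0 : M), b) ∈ G' → b = 0 := by
      rintro b ⟨s, hs⟩
      have hs1 : (s : M) = 0 := congrArg Prod.fst hs
      have hs2 : χ' s = b := congrArg Prod.snd hs
      have : s = 0 := Subtype.ext hs1
      rw [← hs2, this, map_zero]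
    refine ⟨χ' ⟨z, Algebra.self_mem_adjoin_singleton G z⟩, hG2 G' h1 h2 ⟨⟨z, Algebra.self_mem_adjoin_singleton G z⟩, rfl⟩⟩
  have hintg : ∀ z : M, IsIntegral G z → ∃ b, (z, b) ∈ G := by
    intro z hz
    apply hext
    haveI : Algebra.IsIntegral G (Algebra.adjoin G {z}) := Algebra.IsIntegral.adjoin (by simpa)
    have hinj : Function.Injective (algebraMap G (Algebra.adjoin G {z})) := by
      intro a b hab
      have : (a : M × Ω).1 = (b : M × Ω).1 := congrArg Subtype.val hab
      apply Subtype.ext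
      refine Prod.ext this ?_
      apply huniq (a : M × Ω).1
      · exact a.2
      · rw [this]; exact b.2
    obtain ⟨Q, hQ, e⟩ := Ideal.exists_ideal_over_maximal_of_isIntegral
      (S := Algebra.adjoin G {z}) m (by
        rw [(RingHom.injective_iff_ker_eq_bot _).mp hinj]; exact bot_le)
    intro htop
    have : m.map (algebraMap G (Algebra.adjoin G {z})) ≤ Q := Ideal.map_le_iff_le_comap.mpr e.ge
    rw [htop] at this
    exact hQ.ne_top (top_le_iff.mp this)
  have hval : ∀ z : M, (∃ b, (z, b) ∈ G) ∨ ∃ b, (z⁻¹, b) ∈ G := by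
    intro z
    rcases eq_or_ne z 0 with rfl | hz0
    · exact Or.inl ⟨0, G.zero_mem⟩
    by_cases htop : m.map (algebraMap G (Algebra.adjoin G {z})) = ⊤
    · right
      apply hintg
      letI := invertibleOfNonzero hz0
      obtain ⟨p, hp, hpz⟩ := Algebra.exists_aeval_invOf_eq_zero_of_idealMap_adjoin_sup_span_eq_top z m hmtop
        (top_unique (htop.ge.trans le_self_add))
      have H : IsUnit p.leadingCoeff := hunit _ (fun h => by
        have h1 := sub_mem h hp
        rw [sub_sub_cancel] at h1
        exact (Ideal.ne_top_iff_one m).mp hmtop h1)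
      rw [invOf_eq_inv] at hpz
      exact integral_of_unit_lc p H hpz
    · exact Or.inl (hext z htop)
  let V : ValuationSubring M :=
    { (G.map (RingHom.fst M Ω)) with
      mem_or_inv_mem' := by
        intro z
        rcases hval z with ⟨b, hb⟩ | ⟨b, hb⟩
        · left; exact ⟨_, hb, rfl⟩
        · right; exact ⟨_, hb, rfl⟩ }
  have hV : ∀ z : V, ∃ b, ((z : M), b) ∈ G := by
    rintro ⟨z, ⟨⟨z', b⟩, h, rfl⟩⟩
    exact ⟨b, h⟩
  choose f hf using hV
  let ψ : V →+* Ω :=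
    { toFun := f
      map_one' := huniq _ _ _ (hf 1) G.one_mem
      map_zero' := huniq _ _ _ (hf 0) G.zero_mem
      map_add' := fun a b => huniq _ _ _ (hf (a + b)) (G.add_mem (hf a) (hf b))
      map_mul' := fun a b => huniq _ _ _ (hf (a * b)) (G.mul_mem (hf a) (hf b)) }
  refine ⟨⟨V, ψ, ?_⟩, ?_, ?_⟩
  · intro z hz
    exact ⟨_, hloc _ _ (hf z) hz, rfl⟩
  · intro r
    exact ⟨_, hG0 ⟨r, rfl⟩, rfl⟩
  · intro r
    exact huniq _ _ _ (hf _) (hG0 ⟨r, rfl⟩)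
end place

section graph
variable {M Ω : Type*} [Field M] [Field Ω]

/-- Graph of a place. -/
def Plc.R (P : Plc M Ω) (a : M) (b : Ω) : Prop := ∃ h : a ∈ P.V, P.ψ ⟨a, h⟩ = b

variable {P : Plc M Ω}

theorem Plc.R.mem {a : M} {b : Ω} (h : P.R a b) : a ∈ P.V := h.1

theorem Plc.R.uniq {a : M} {b c : Ω} (h : P.R a b) (h' : P.R a c) : b = c := by
  obtain ⟨h, rfl⟩ := h
  obtain ⟨h', rfl⟩ := h'
  rfl

theorem Plc.R.of_mem {a : M} (h : a ∈ P.V) : P.R a (P.ψ ⟨a, h⟩) := ⟨h, rfl⟩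

theorem Plc.R_zero (P : Plc M Ω) : P.R 0 0 := ⟨P.V.zero_mem, map_zero P.ψ⟩

theorem Plc.R_one (P : Plc M Ω) : P.R 1 1 := ⟨P.V.one_mem, map_one P.ψ⟩

theorem Plc.R.add {a a' : M} {b b' : Ω} (h : P.R a b) (h' : P.R a' b') :
    P.R (a + a') (b + b') := by
  obtain ⟨h, rfl⟩ := h
  obtain ⟨h', rfl⟩ := h'
  exact ⟨P.V.add_mem _ _ h h', (map_add P.ψ ⟨a, h⟩ ⟨a', h'⟩)⟩

theorem Plc.R.mul {a a' : M} {b b' : Ω} (h : P.R a b) (h' : P.R a' b') :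
    P.R (a * a') (b * b') := by
  obtain ⟨h, rfl⟩ := h
  obtain ⟨h', rfl⟩ := h'
  exact ⟨P.V.mul_mem _ _ h h', (map_mul P.ψ ⟨a, h⟩ ⟨a', h'⟩)⟩

theorem Plc.R.neg {a : M} {b : Ω} (h : P.R a b) : P.R (-a) (-b) := by
  obtain ⟨h, rfl⟩ := h
  exact ⟨P.V.neg_mem _ h, (map_neg P.ψ ⟨a, h⟩)⟩

theorem Plc.R.pow {a : M} {b : Ω} (h : P.R a b) (n : ℕ) : P.R (a ^ n) (b ^ n) := by
  induction n with
  | zero => simpa using P.R_one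
  | succ n ih => simpa [pow_succ] using ih.mul h

theorem Plc.R.sum {ι : Type*} (s : Finset ι) {f : ι → M} {g : ι → Ω}
    (h : ∀ i ∈ s, P.R (f i) (g i)) : P.R (∑ i ∈ s, f i) (∑ i ∈ s, g i) := by
  classical
  induction s using Finset.induction_on with
  | empty => simpa using P.R_zero
  | insert a s ha ih =>
    rw [Finset.sum_insert ha, Finset.sum_insert ha]
    exact (h a (Finset.mem_insert_self a s)).add
      (ih fun i hi => h i (Finset.mem_insert_of_mem hi))

theorem Plc.R.prod {ι : Type*} (s : Finset ι) {f : ι → M} {g : ι → Ω}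
    (h : ∀ i ∈ s, P.R (f i) (g i)) : P.R (∏ i ∈ s, f i) (∏ i ∈ s, g i) := by
  classical
  induction s using Finset.induction_on with
  | empty => simpa using P.R_one
  | insert a s ha ih =>
    rw [Finset.prod_insert ha, Finset.prod_insert ha]
    exact (h a (Finset.mem_insert_self a s)).mul
      (ih fun i hi => h i (Finset.mem_insert_of_mem hi))

theorem Plc.R.inv_mem {a : M} {b : Ω} (h : P.R a b) (hb : b ≠ 0) : a⁻¹ ∈ P.V := by
  obtain ⟨h, rfl⟩ := h
  exact P.loc ⟨a, h⟩ hb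

theorem Plc.R.ne_zero {a : M} {b : Ω} (h : P.R a b) (hb : b ≠ 0) : a ≠ 0 := by
  rintro rfl
  exact hb (h.uniq P.R_zero)

theorem Plc.R.inv {a : M} {b : Ω} (h : P.R a b) (hb : b ≠ 0) : P.R a⁻¹ b⁻¹ := by
  have h1 := Plc.R.of_mem (h.inv_mem hb)
  have h2 := h.mul h1
  rw [mul_inv_cancel₀ (h.ne_zero hb)] at h2
  have h3 := h2.uniq P.R_one
  rwa [eq_inv_of_mul_eq_one_right h3] at h1

theorem Plc.R.ne_zero_of_inv {a : M} {b : Ω} (h : P.R a b) (ha : a ≠ 0) (hb : a⁻¹ ∈ P.V) :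
    b ≠ 0 := by
  rintro rfl
  have h2 := h.mul (Plc.R.of_mem hb)
  rw [mul_inv_cancel₀ ha, zero_mul] at h2
  exact zero_ne_one (h2.uniq P.R_one)

theorem Plc.mem_of_integral (P : Plc M Ω) {z : M} (h : IsIntegral P.V z) : z ∈ P.V := by
  obtain ⟨y, rfl⟩ := (IsIntegrallyClosed.isIntegral_iff (R := P.V) (K := M)).mp h
  exact y.2

/-- A zero of a polynomial with coefficients in `V` and unit leading coefficient is in `V`. -/
theorem Plc.mem_of_root (P : Plc M Ω) (q : Polynomial M) (hq : ∀ i, q.coeff i ∈ P.V)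
    (hl : q.leadingCoeff ≠ 0) (hl' : (q.leadingCoeff)⁻¹ ∈ P.V) {z : M} (hz : q.eval z = 0) : z ∈ P.V := by
  have : q ∈ Polynomial.lifts (algebraMap P.V M) := by
    rw [Polynomial.lifts_iff_coeff_lifts]
    intro n
    exact ⟨⟨_, hq n⟩, rfl⟩
  obtain ⟨q', rfl⟩ := this
  simp only [Polynomial.coe_mapRingHom] at *
  apply P.mem_of_integral
  refine integral_of_unit_lc q' ?_ (z := z) ?_
  · have hinj : Function.Injective (algebraMap P.V M) := Subtype.val_injective
    rw [Polynomial.leadingCoeff_map_of_injective hinj] at hl hl'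
    refine IsUnit.of_mul_eq_one (⟨_, hl'⟩ : P.V) ?_
    apply hinj
    rw [map_mul, map_one]
    exact mul_inv_cancel₀ hl
  · rwa [Polynomial.aeval_def, ← Polynomial.eval_map]

variable {k L : Type*} [Field k] [Field L] [Algebra k Ω] [Algebra L M]

/-- Reduction of a polynomial along a place. -/
theorem Plc.reduce (P : Plc M Ω)
    (hL : ∀ (l : L) b, P.R (algebraMap L M l) b → IsAlgebraic k b)
    {σ : Type*} (p : MvPolynomial σ L) (hp : ∀ m, algebraMap L M (p.coeff m) ∈ P.V)
    (z : σ → M) (w : σ → Ω) (hzw : ∀ i, P.R (z i) (w i)) :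
    ∃ q : MvPolynomial σ (algebraicClosure k Ω),
      (∀ m, P.R (algebraMap L M (p.coeff m)) ((q.coeff m : algebraicClosure k Ω) : Ω)) ∧
      P.R (MvPolynomial.aeval z p) (MvPolynomial.aeval w q) := by
  classical
  have H : ∀ m, ∃ b : algebraicClosure k Ω, P.R (algebraMap L M (p.coeff m)) b := fun m =>
    ⟨⟨_, mem_algebraicClosure_iff.mpr (hL _ _ (Plc.R.of_mem (hp m)))⟩, Plc.R.of_mem (hp m)⟩
  choose g hg using H
  have hg0 : ∀ m, m ∉ p.support → g m = 0 := by
    intro m hm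
    have := hg m
    rw [MvPolynomial.notMem_support_iff.mp hm, map_zero] at this
    exact Subtype.ext (this.uniq P.R_zero)
  refine ⟨∑ m ∈ p.support, MvPolynomial.monomial m (g m), ?_, ?_⟩
  · intro m
    rw [MvPolynomial.coeff_sum]
    simp only [MvPolynomial.coeff_monomial, Finset.sum_ite_eq']
    split_ifs with h
    · exact hg m
    · rw [← hg0 m h]; exact hg m
  · conv_lhs => rw [← MvPolynomial.support_sum_monomial_coeff p]
    simp only [map_sum, MvPolynomial.aeval_monomial]
    refine Plc.R.sum _ fun m _ => (hg m).mul ?_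
    exact Plc.R.prod _ fun i _ => (hzw i).pow _

end graph

section graph2

theorem scaling {M : Type*} [Field M] (V : ValuationSubring M) {α : Type*} (s : Finset α) (a : α → M)
    (h : ∃ i ∈ s, a i ≠ 0) :
    ∃ j ∈ s, a j ≠ 0 ∧ ∀ i ∈ s, (a j)⁻¹ * a i ∈ V := by
  obtain ⟨i₀, hi₀, h0⟩ := h
  obtain ⟨j, hj, hmax⟩ := s.exists_max_image (fun i => V.valuation (a i)) ⟨i₀, hi₀⟩
  have hj0 : a j ≠ 0 := by
    intro hj0
    have := hmax i₀ hi₀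
    rw [hj0, map_zero, le_zero_iff, map_eq_zero] at this
    exact h0 this
  refine ⟨j, hj, hj0, fun i hi => ?_⟩
  rw [← V.valuation_le_one_iff, map_mul, map_inv₀]
  have hpos : V.valuation (a j) ≠ 0 := by simpa using hj0
  calc _ ≤ (V.valuation (a j))⁻¹ * V.valuation (a j) := by gcongr; exact hmax i hi
    _ = 1 := inv_mul_cancel₀ hpos

variable {M Ω : Type*} [Field M] [Field Ω]
variable {k L : Type*} [Field k] [Field L] [Algebra k Ω] [Algebra L M]

theorem Plc.EF {σ : Type*} {u : σ → M} {z : M}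
    (hz : IsAlgebraic (Algebra.adjoin L (Set.range u)) z) :
    ∃ (T : Finset L) (p : MvPolynomial σ L), MvPolynomial.aeval u p ≠ 0 ∧
      (∀ m ∈ p.support, p.coeff m ∈ T) ∧
      ∀ (P : Plc M Ω) (_ : ∀ (l : L) b, P.R (algebraMap L M l) b → IsAlgebraic k b)
        (w : σ → Ω) (_ : ∀ i, P.R (u i) (w i)), (∀ l ∈ T, algebraMap L M l ∈ P.V) →
        ∀ c ≠ 0, P.R (MvPolynomial.aeval u p) c → z ∈ P.V ∧
          ∀ z', P.R z z' → IsAlgebraic (Algebra.adjoin (algebraicClosure k Ω) (Set.range w)) z' := by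
  classical
  obtain ⟨q, hq0, hq⟩ := hz
  have H : ∀ i, ∃ p : MvPolynomial σ L, MvPolynomial.aeval u p = (q.coeff i : M) := by
    intro i
    exact (Algebra.adjoin_range_eq_range_aeval L u).le (q.coeff i).2
  choose p hp using H
  set d := q.natDegree with hd
  have hlead : (q.coeff d : M) ≠ 0 := by
    intro h
    exact hq0 (Polynomial.leadingCoeff_eq_zero.mp (Subtype.ext h))
  refine ⟨(Finset.range (d+1)).biUnion fun i => (p i).support.image fun m => (p i).coeff m,
    p d, by rwa [hp], ?_, ?_⟩
  · intro m hm
    rw [Finset.mem_biUnion]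
    exact ⟨d, by simp, Finset.mem_image_of_mem _ hm⟩
  intro P hL w hw hT c hc hRc
  have hcoef : ∀ i ∈ Finset.range (d+1), ∀ m, algebraMap L M ((p i).coeff m) ∈ P.V := by
    intro i hi m
    by_cases hm : m ∈ (p i).support
    · exact hT _ (Finset.mem_biUnion.mpr ⟨i, hi, Finset.mem_image_of_mem _ hm⟩)
    · rw [MvPolynomial.notMem_support_iff.mp hm, map_zero]
      exact P.V.zero_mem
  have H2 : ∀ i, ∃ g : MvPolynomial σ (algebraicClosure k Ω), i ∈ Finset.range (d+1) →
      P.R (q.coeff i : M) (MvPolynomial.aeval w g) := by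
    intro i
    by_cases hi : i ∈ Finset.range (d+1)
    · obtain ⟨g, -, hg⟩ := P.reduce hL (p i) (hcoef i hi) u w hw
      rw [hp] at hg
      exact ⟨g, fun _ => hg⟩
    · exact ⟨0, fun h => absurd h hi⟩
  choose g hg using H2
  rw [hp] at hRc
  have hev : ∑ i ∈ Finset.range (d+1), (q.coeff i : M) * z ^ i = 0 := by
    rw [Polynomial.aeval_eq_sum_range] at hq
    simpa [Algebra.smul_def] using hq
  constructor
  · refine P.mem_of_root (q.map (algebraMap _ M)) ?_ ?_ ?_ (z := z) ?_
    · intro i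
      rw [Polynomial.coeff_map]
      by_cases hi : i ∈ Finset.range (d+1)
      · exact (hg i hi).mem
      · rw [Polynomial.coeff_eq_zero_of_natDegree_lt (by simp at hi; omega), map_zero]
        exact P.V.zero_mem
    · rw [Polynomial.leadingCoeff_map_of_injective Subtype.val_injective]
      exact hlead
    · rw [Polynomial.leadingCoeff_map_of_injective Subtype.val_injective]
      exact hRc.inv_mem hc
    · rwa [Polynomial.eval_map, ← Polynomial.aeval_def]
  · intro z' hz'
    have hmem : ∀ i, MvPolynomial.aeval w (g i) ∈ Algebra.adjoin (algebraicClosure k Ω) (Set.range w) := by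
      intro i
      rw [Algebra.adjoin_range_eq_range_aeval]
      exact ⟨_, rfl⟩
    refine ⟨∑ i ∈ Finset.range (d+1), Polynomial.monomial i (⟨_, hmem i⟩ : Algebra.adjoin (algebraicClosure k Ω) (Set.range w)), ?_, ?_⟩
    · intro h0
      have := congrArg (fun f => f.coeff d) h0
      simp only [Polynomial.finsetSum_coeff, Polynomial.coeff_monomial, Finset.sum_ite_eq', Polynomial.coeff_zero] at this
      rw [if_pos (by simp)] at this
      have h3 := congrArg Subtype.val this
      have h4 := (hg d (by simp)).uniq hRc
      exact hc (h4.symm.trans h3)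
    · rw [map_sum]
      simp only [Polynomial.aeval_monomial]
      have := Plc.R.sum (P := P) (Finset.range (d+1)) (f := fun i => (q.coeff i : M) * z ^ i)
        (g := fun i => MvPolynomial.aeval w (g i) * z' ^ i) (fun i hi => (hg i hi).mul (hz'.pow i))
      rw [hev] at this
      exact this.uniq P.R_zero

/-- Elements algebraic over `L(x)` are finite at good places. -/
theorem Plc.mem_of_good {σ : Type*} {u : σ → M} {z : M}
    (hz : IsAlgebraic (Algebra.adjoin L (Set.range u)) z) :
    ∃ (T : Finset L), 
      ∀ (P : Plc M Ω) (_ : ∀ (l : L) b, P.R (algebraMap L M l) b → IsAlgebraic k b)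
        (w : σ → Ω) (_ : ∀ i, P.R (u i) (w i)) (_ : AlgebraicIndependent (algebraicClosure k Ω) w),
          (∀ l ∈ T, algebraMap L M l ∈ P.V) → z ∈ P.V := by
  classical
  obtain ⟨T, p, hp0, hT, h⟩ := Plc.EF (k := k) (Ω := Ω) hz
  have hp : p ≠ 0 := by rintro rfl; simp at hp0
  obtain ⟨m, hm⟩ := MvPolynomial.ne_zero_iff.mp hp
  refine ⟨insert (p.coeff m)⁻¹ T, fun P hL w hw hind hTV => ?_⟩
  have hpm : ∀ m, algebraMap L M (p.coeff m) ∈ P.V := by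
    intro m
    by_cases hm : m ∈ p.support
    · exact hTV _ (Finset.mem_insert_of_mem (hT _ hm))
    · rw [MvPolynomial.notMem_support_iff.mp hm, map_zero]
      exact P.V.zero_mem
  obtain ⟨g, hg1, hg2⟩ := P.reduce hL p hpm u w hw
  refine (h P hL w hw (fun l hl => hTV l (Finset.mem_insert_of_mem hl)) _ ?_ hg2).1
  intro h0
  have : g = 0 := hind (by simpa using h0)
  have h1 := hg1 m
  refine Plc.R.ne_zero_of_inv h1 (by simpa using hm) ?_ ?_
  · rw [← map_inv₀]; exact hTV _ (Finset.mem_insert_self _ _)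
  · rw [this]; simp

/-- An algebraic relation over `L` specializes to an algebraic relation. -/
theorem Plc.dep (P : Plc M Ω) (hL : ∀ (l : L) b, P.R (algebraMap L M l) b → IsAlgebraic k b)
    {σ : Type*} {u : σ → M} (w : σ → Ω) (hw : ∀ i, P.R (u i) (w i))
    (hu : ¬ AlgebraicIndependent L u) : ¬ AlgebraicIndependent (algebraicClosure k Ω) w := by
  classical
  intro hind
  apply hu
  rw [algebraicIndependent_iff]
  intro p hp
  by_contra hp0
  obtain ⟨m, hm⟩ := MvPolynomial.ne_zero_iff.mp hp0
  obtain ⟨j, hj, hj0, hsc⟩ := scaling P.V p.support (fun m => algebraMap L M (p.coeff m))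
    ⟨m, by simpa using hm, by simpa using hm⟩
  have hpm : ∀ m, algebraMap L M ((MvPolynomial.C (p.coeff j)⁻¹ * p).coeff m) ∈ P.V := by
    intro m
    rw [MvPolynomial.coeff_C_mul]
    by_cases hm : m ∈ p.support
    · rw [map_mul, map_inv₀]; exact hsc m hm
    · rw [MvPolynomial.notMem_support_iff.mp hm, mul_zero, map_zero]
      exact P.V.zero_mem
  obtain ⟨g, hg1, hg2⟩ := P.reduce hL _ hpm u w hw
  rw [map_mul, hp, mul_zero] at hg2
  have : g = 0 := hind (by rw [hg2.uniq P.R_zero, map_zero])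
  have h1 := hg1 j
  rw [MvPolynomial.coeff_C_mul, inv_mul_cancel₀ (by simpa using hj0), map_one, this] at h1
  exact one_ne_zero (P.R_one.uniq h1)

end graph2

section goodplace

theorem exists_hom_aux (k F : Type*) [Field k] [Field F] [Algebra k F] [Algebra.FiniteType k F] :
    Nonempty (F →ₐ[k] AlgebraicClosure k) := by
  have hfin : Module.Finite k F := finite_of_finite_type_of_isJacobsonRing _ _
  have : Algebra.IsAlgebraic k F := Algebra.IsAlgebraic.of_finite k _
  exact ⟨IsAlgClosed.lift⟩

theorem exists_hom_aux' (k A : Type*) [Field k] [CommRing A] [Nontrivial A] [Algebra k A]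
    [Algebra.FiniteType k A] :
    Nonempty (A →ₐ[k] AlgebraicClosure k) := by
  obtain ⟨m, hm⟩ := Ideal.exists_maximal A
  letI := Ideal.Quotient.field m
  have : Algebra.FiniteType k (A ⧸ m) :=
    Algebra.FiniteType.of_surjective (Ideal.Quotient.mkₐ k m) (Ideal.Quotient.mkₐ_surjective k m)
  obtain ⟨g⟩ := exists_hom_aux k (A ⧸ m)
  exact ⟨g.comp (Ideal.Quotient.mkₐ k m)⟩

theorem exists_hom_of_finite (k L : Type*) [Field k] [Field L] [Algebra k L] (T : Finset L) :
    Nonempty (Algebra.adjoin k (T : Set L) →ₐ[k] AlgebraicClosure k) := by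
  have hft : Algebra.FiniteType k (Algebra.adjoin k (T : Set L)) :=
    (Subalgebra.fg_iff_finiteType _).mp (Subalgebra.fg_adjoin_finset T)
  exact exists_hom_aux' k _

theorem exists_good {k L M Ω ι : Type*} [Field k] [Field L] [Field M] [Field Ω] [Algebra k L]
    [Algebra k M] [Algebra L M] [IsScalarTower k L M] [Algebra k Ω] [IsAlgClosed Ω]
    (x : ι → M) (hx : AlgebraicIndependent L x) (w : ι → Ω) (T : Finset L) :
    ∃ P : Plc M Ω, (∀ l ∈ T, algebraMap L M l ∈ P.V) ∧
      (∀ c : k, P.R (algebraMap k M c) (algebraMap k Ω c)) ∧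
      (∀ (l : L) b, P.R (algebraMap L M l) b → IsAlgebraic k b) ∧
      ∀ i, P.R (x i) (w i) := by
  obtain ⟨φ0⟩ := exists_hom_of_finite k L T
  obtain ⟨P0, h0, hP0⟩ := exists_plc (M := L) (Ω := AlgebraicClosure k)
    (Algebra.adjoin k (T : Set L)).val.toRingHom φ0.toRingHom (by
      intro r hr
      have : r = 0 := Subtype.ext hr
      rw [this, map_zero])
  let j : AlgebraicClosure k →ₐ[k] Ω := IsAlgClosed.lift
  let i1 : MvPolynomial ι P0.V →+* M := MvPolynomial.eval₂Hom ((algebraMap L M).comp P0.V.subtype) x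
  let i2 : MvPolynomial ι P0.V →+* Ω := MvPolynomial.eval₂Hom (j.toRingHom.comp P0.ψ) w
  have hi1 : ∀ r, i1 r = MvPolynomial.aeval x (MvPolynomial.map P0.V.subtype r) := by
    intro r
    rw [MvPolynomial.aeval_def, MvPolynomial.eval₂_map]
    rfl
  obtain ⟨P, h, hP⟩ := exists_plc i1 i2 (by
    intro r hr
    rw [hi1] at hr
    have h1 : MvPolynomial.map P0.V.subtype r = 0 := hx (by rw [hr, map_zero])
    have : r = 0 := MvPolynomial.map_injective _ Subtype.val_injective (by rw [h1, map_zero])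
    rw [this, map_zero])
  have hC : ∀ l (hl : l ∈ P0.V), P.R (algebraMap L M l) (j (P0.ψ ⟨l, hl⟩)) := by
    intro l hl
    have h1 := hP (MvPolynomial.C ⟨l, hl⟩)
    have : P.R (i1 (MvPolynomial.C ⟨l, hl⟩)) (i2 (MvPolynomial.C ⟨l, hl⟩)) := ⟨_, h1⟩
    simpa [i1, i2] using this
  refine ⟨P, ?_, ?_, ?_, ?_⟩
  · intro l hl
    exact (hC l (h0 ⟨l, Algebra.subset_adjoin hl⟩)).mem
  · intro c
    have := hC _ (h0 (algebraMap k _ c))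
    rw [hP0 (algebraMap k _ c)] at this
    have h2 : (Algebra.adjoin k (T : Set L)).val.toRingHom (algebraMap k _ c) = algebraMap k L c := rfl
    rw [h2, ← IsScalarTower.algebraMap_apply] at this
    simpa using this
  · intro l b hb
    by_cases hl : l ∈ P0.V
    · rw [hb.uniq (hC l hl)]
      exact (Algebra.IsAlgebraic.isAlgebraic (R := k) (P0.ψ ⟨l, hl⟩)).algHom j
    · exfalso
      have hl' : l⁻¹ ∈ P0.V := (P0.V.mem_or_inv_mem l).resolve_left hl
      have hz : P0.ψ ⟨l⁻¹, hl'⟩ = 0 := by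
        by_contra hne
        have := P0.loc _ hne
        simp only [inv_inv] at this
        exact hl this
      have h3 := hC _ hl'
      rw [hz, map_zero] at h3
      have hl0 : l ≠ 0 := by rintro rfl; exact hl P0.V.zero_mem
      have h4 := hb.mul h3
      rw [← map_mul, mul_inv_cancel₀ hl0, map_one, mul_zero] at h4
      exact one_ne_zero (P.R_one.uniq h4)
  · intro n
    have h1 := hP (MvPolynomial.X n)
    have : P.R (i1 (MvPolynomial.X n)) (i2 (MvPolynomial.X n)) := ⟨_, h1⟩
    simpa [i1, i2] using this

end goodplace

section rankbound
open IntermediateField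
open scoped IntermediateField.algebraAdjoinAdjoin

/-- Clearing denominators in a linear relation over `B(t)`. -/
theorem exists_poly_rel {B M : Type*} [Field B] [Field M] [Algebra B M] (t : M) {s : Type*} [Fintype s]
    (a : s → M) (h : ¬ LinearIndependent B⟮t⟯ a) :
    ∃ f : s → Polynomial B, ∑ c, Polynomial.aeval t (f c) * a c = 0 ∧ ∃ c, f c ≠ 0 := by
  rw [← LinearIndependent.iff_fractionRing (Algebra.adjoin B {t}), Fintype.not_linearIndependent_iff] at h
  obtain ⟨g, hg, c, hc⟩ := h
  have H : ∀ c, ∃ f : Polynomial B, Polynomial.aeval t f = (g c : M) := by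
    intro c
    exact (Algebra.adjoin_singleton_eq_range_aeval B t).le (g c).2
  choose f hf using H
  refine ⟨f, ?_, c, ?_⟩
  · rw [← hg]
    refine Finset.sum_congr rfl fun c _ => ?_
    rw [hf]; rfl
  · intro h0
    apply hc
    apply Subtype.ext
    rw [← hf, h0, map_zero]; rfl

theorem linIndep_poly {B M : Type*} [Field B] [Field M] [Algebra B M] {t : M} (ht : Transcendental B t)
    {s : Type*} [Fintype s]
    (a : s → M) (h : LinearIndependent B⟮t⟯ a)
    (f : s → Polynomial B) (hf : ∑ c, Polynomial.aeval t (f c) * a c = 0) (c : s) : f c = 0 := by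
  rw [← LinearIndependent.iff_fractionRing (Algebra.adjoin B {t}), Fintype.linearIndependent_iff] at h
  have hm : ∀ c, Polynomial.aeval t (f c) ∈ Algebra.adjoin B {t} := fun c =>
    (Algebra.adjoin_singleton_eq_range_aeval B t).ge ⟨_, rfl⟩
  have := h (fun c => ⟨_, hm c⟩) hf c
  have h2 : Polynomial.aeval t (f c) = 0 := congrArg Subtype.val this
  by_contra hne
  exact ht ⟨_, hne, h2⟩

theorem Plc.rank_bound {k L M Ω : Type*} [Field k] [Field L] [Field M] [Field Ω]
    [Algebra L M] [Algebra k Ω] (P : Plc M Ω) (B : IntermediateField L M) (t : M)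
    (B1 : IntermediateField k Ω) (hB1 : ∀ b ∈ B, ∀ c, P.R b c → c ∈ B1) (t1 : Ω) (htt : P.R t t1)
    (ht1 : Transcendental B1 t1) (C : IntermediateField B1⟮t1⟯ Ω) (hC : ∀ c ∈ C, ∃ a, P.R a c)
    (e : ℕ) (hr : Module.rank B⟮t⟯ M ≤ e) : Module.rank B1⟮t1⟯ C ≤ e := by
  classical
  refine rank_le fun s hs => ?_
  by_contra hcard
  have hs' : LinearIndependent B1⟮t1⟯ (fun i : s => ((i : C) : Ω)) :=
    hs.map' C.toSubalgebra.val.toLinearMap (LinearMap.ker_eq_bot.mpr Subtype.val_injective)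
  have H : ∀ c : s, ∃ a, P.R a ((c : C) : Ω) := fun c => hC _ (c : C).2
  choose a ha using H
  have hnot : ¬ LinearIndependent B⟮t⟯ a := by
    intro hli
    have h1 := hli.cardinal_lift_le_rank
    have h2 := h1.trans (Cardinal.lift_le.mpr hr)
    simp at h2
    omega
  obtain ⟨f, hf, c0, hc0⟩ := exists_poly_rel t a hnot
  obtain ⟨N, hN⟩ : ∃ N : ℕ, ∀ c, (f c).natDegree < N := by
    refine ⟨Finset.univ.sup (fun c => (f c).natDegree) + 1, fun c => ?_⟩
    exact Nat.lt_succ_of_le (Finset.le_sup (f := fun c => (f c).natDegree) (Finset.mem_univ c))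
  obtain ⟨⟨c1, n1⟩, hm1, hb, hsc⟩ := scaling P.V ((Finset.univ : Finset s) ×ˢ Finset.range N)
    (fun q => ((f q.1).coeff q.2 : M)) ⟨(c0, (f c0).natDegree), by simp [hN], by
      simpa using hc0⟩
  simp only at hb hsc
  set b := (f c1).coeff n1 with hbdef
  have H2 : ∀ (c : s) (n : ℕ), ∃ h : B1, n < N → P.R ((b : M)⁻¹ * ((f c).coeff n : M)) h := by
    intro c n
    by_cases hn : n < N
    · have h1 := Plc.R.of_mem (hsc (c, n) (by simp [hn]))
      exact ⟨⟨_, hB1 _ (B.mul_mem (B.inv_mem b.2) ((f c).coeff n).2) _ h1⟩, fun _ => h1⟩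
    · exact ⟨0, fun h => absurd h hn⟩
  choose h hh using H2
  let F : s → Polynomial B1 := fun c => ∑ n ∈ Finset.range N, Polynomial.monomial n (h c n)
  have hF : ∀ c, P.R ((b : M)⁻¹ * Polynomial.aeval t (f c)) (Polynomial.aeval t1 (F c)) := by
    intro c
    rw [Polynomial.aeval_eq_sum_range' (hN c), Finset.mul_sum]
    simp only [F, map_sum, Polynomial.aeval_monomial]
    refine Plc.R.sum _ fun n hn => ?_
    rw [Algebra.smul_def, ← mul_assoc]
    exact (hh c n (Finset.mem_range.mp hn)).mul (htt.pow n)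
  have hsum : ∑ c, Polynomial.aeval t1 (F c) * ((c : C) : Ω) = 0 := by
    have h1 := Plc.R.sum (P := P) Finset.univ fun c _ => (hF c).mul (ha c)
    have h2 : ∑ c, (b : M)⁻¹ * Polynomial.aeval t (f c) * a c = 0 := by
      simp only [mul_assoc]
      rw [← Finset.mul_sum, hf, mul_zero]
    rw [h2] at h1
    exact h1.uniq P.R_zero
  have hz := linIndep_poly ht1 _ hs' F hsum c1
  have hz' := congrArg (fun q => q.coeff n1) hz
  have hn1 : n1 < N := by simpa using hm1
  simp only [F, Polynomial.finsetSum_coeff, Polynomial.coeff_monomial, Finset.sum_ite_eq', Polynomial.coeff_zero,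
    Finset.mem_range, if_pos hn1] at hz'
  have h5 := hh c1 n1 hn1
  rw [hz', ← hbdef, inv_mul_cancel₀ hb] at h5
  exact one_ne_zero (P.R_one.uniq h5)

end rankbound

section lemD
open IntermediateField

/-- Weak output form of a covering diagram, inside a big field `Ω`. -/
def WeakDiag (k K Ω : Type*) [Field k] [Field K] [Field Ω] [Algebra k K] [Algebra k Ω] (e : ℕ) : Prop :=
  ∃ (B : IntermediateField k Ω) (t : Ω) (C : IntermediateField B⟮t⟯ Ω) (f : K →ₐ[k] Ω),
    Transcendental B t ∧ f.toRingHom.IsIntegral ∧ (∀ a, f a ∈ C) ∧ Module.rank B⟮t⟯ C ≤ e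

theorem isAlgebraic_of_range {R S Ω : Type*} [CommRing R] [CommRing S] [Field Ω] [Algebra R Ω]
    [Algebra S Ω] [FaithfulSMul R Ω] (h : ∀ r : R, ∃ s : S, algebraMap S Ω s = algebraMap R Ω r)
    {a : Ω} (ha : IsAlgebraic R a) : IsAlgebraic S a := by
  obtain ⟨p, hp, hpa⟩ := ha
  have : p.map (algebraMap R Ω) ∈ Polynomial.lifts (algebraMap S Ω) := by
    rw [Polynomial.lifts_iff_coeff_lifts]
    intro n
    rw [Polynomial.coeff_map]
    exact h _
  obtain ⟨q, hq⟩ := this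
  rw [Polynomial.coe_mapRingHom] at hq
  refine ⟨q, ?_, ?_⟩
  · rintro rfl
    rw [Polynomial.map_zero] at hq
    exact hp ((Polynomial.map_eq_zero_iff (FaithfulSMul.algebraMap_injective R Ω)).mp hq.symm)
  · rw [Polynomial.aeval_def, ← Polynomial.eval_map, hq, Polynomial.eval_map, ← Polynomial.aeval_def, hpa]

theorem isAlgebraic_image {k K M : Type*} [Field k] [Field K] [Field M] [Algebra k K] [Algebra k M]
    (g : K →ₐ[k] M) (s : Set K) {a : K} (h : IsAlgebraic (Algebra.adjoin k s) a) :
    IsAlgebraic (Algebra.adjoin k (g '' s)) (g a) := by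
  have hm : ∀ r : Algebra.adjoin k s, g r ∈ Algebra.adjoin k (g '' s) := by
    intro r
    rw [← AlgHom.map_adjoin]
    exact ⟨_, r.2, rfl⟩
  refine h.ringHom_of_comp_eq ((g.toRingHom.comp (Algebra.adjoin k s).val.toRingHom).codRestrict
    (Algebra.adjoin k (g '' s)) hm) g ?_ ?_
  · intro a b hab
    exact Subtype.ext (g.injective (congrArg Subtype.val hab))
  · rfl

/-- Transcendence basis from a transcendence basis of `B` and `t`. -/
theorem trbasis_option {L M κ : Type*} [Field L] [Field M] [Algebra L M] (B : IntermediateField L M) (t : M)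
    (ht : Transcendental B t) (halg : Algebra.IsAlgebraic B⟮t⟯ M) (y : κ → B)
    (hy : IsTranscendenceBasis L y) :
    IsTranscendenceBasis L (fun o : Option κ => o.elim t (fun i => (y i : M))) := by
  have h1 : IsTranscendenceBasis B (fun _ : PUnit.{1} => t) := by
    rw [isTranscendenceBasis_iff_algebraicIndependent_isAlgebraic]
    refine ⟨algebraicIndependent_unique_type_iff.mpr ht, ?_⟩
    rw [Set.range_const]
    exact isAlgebraic_adjoin_iff_top.mp halg
  have h2 := hy.sumElim_comp h1
  rw [← isTranscendenceBasis_equiv ((Equiv.optionEquivSumPUnit.{0} κ).trans (Equiv.sumComm _ _))] at h2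
  convert h2 using 2 with o
  cases o <;> rfl

/-- Finiteness data yields a place with all the required properties. -/
theorem exists_plc_data {k L K M Ω ι κ : Type*} [Field k] [Field L] [Field K] [Field M] [Field Ω]
    [Algebra k L] [Algebra k K] [Algebra k M] [Algebra L M] [Algebra K M] [IsScalarTower k L M]
    [IsScalarTower k K M] [Algebra k Ω] [Algebra K Ω] [IsScalarTower k K Ω] [IsAlgClosed Ω]
    [Algebra.IsAlgebraic K Ω] [Finite ι] (x : ι → K) (hx : IsTranscendenceBasis k x)
    (hxM : IsTranscendenceBasis L (algebraMap K M ∘ x))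
    (u : Option κ → M) (hu : IsTranscendenceBasis L u) :
    ∃ (P : Plc M Ω) (w : Option κ → Ω), 
      (∀ c : k, P.R (algebraMap k M c) (algebraMap k Ω c)) ∧
      (∀ (l : L) b, P.R (algebraMap L M l) b → IsAlgebraic k b) ∧
      (∀ i, P.R (algebraMap K M (x i)) (algebraMap K Ω (x i))) ∧ (∀ o, P.R (u o) (w o)) ∧
      AlgebraicIndependent (algebraicClosure k Ω) w := by
  classical
  have : Fintype ι := Fintype.ofFinite ι
  obtain ⟨eqv⟩ := Cardinal.lift_mk_eq'.mp (hu.lift_cardinalMk_eq hxM)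
  have : Finite (Option κ) := Finite.of_equiv _ eqv.symm
  have : Fintype (Option κ) := Fintype.ofFinite _
  have hw : IsTranscendenceBasis k (algebraMap K Ω ∘ x) := hx.algebraMap_comp
  have hwE : AlgebraicIndependent (algebraicClosure k Ω) (algebraMap K Ω ∘ x) := hw.1.algebraicClosure
  have hMx : ∀ z : M, IsAlgebraic (Algebra.adjoin L (Set.range (algebraMap K M ∘ x))) z :=
    fun z => hxM.isAlgebraic.isAlgebraic z
  have hMu : ∀ z : M, IsAlgebraic (Algebra.adjoin L (Set.range u)) z :=
    fun z => hu.isAlgebraic.isAlgebraic z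
  choose T1 hT1 using fun o => Plc.mem_of_good (k := k) (Ω := Ω) (hMx (u o))
  choose T2 p hp0 hpT hT2 using fun i => Plc.EF (k := k) (Ω := Ω) (hMu (algebraMap K M (x i)))
  choose T3 hT3 using fun i => Plc.mem_of_good (k := k) (Ω := Ω) (hMx (MvPolynomial.aeval u (p i)))
  choose T4 hT4 using fun i => Plc.mem_of_good (k := k) (Ω := Ω) (hMx (MvPolynomial.aeval u (p i))⁻¹)
  let T : Finset L := Finset.univ.biUnion T1 ∪ Finset.univ.biUnion (fun i => T2 i ∪ T3 i ∪ T4 i)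
  obtain ⟨P, hPT, hPk, hPL, hPx⟩ := exists_good (k := k) (Ω := Ω) _ hxM.1 (algebraMap K Ω ∘ x) T
  have hu' : ∀ o, u o ∈ P.V := fun o => hT1 o P hPL _ hPx hwE fun l hl =>
    hPT l (Finset.mem_union_left _ (Finset.mem_biUnion.mpr ⟨o, Finset.mem_univ _, hl⟩))
  have hin : ∀ i l, l ∈ T2 i ∪ T3 i ∪ T4 i → algebraMap L M l ∈ P.V := fun i l hl =>
    hPT l (Finset.mem_union_right _ (Finset.mem_biUnion.mpr ⟨i, Finset.mem_univ _, hl⟩))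
  let w : Option κ → Ω := fun o => P.ψ ⟨u o, hu' o⟩
  have hRw : ∀ o, P.R (u o) (w o) := fun o => ⟨_, rfl⟩
  have hxalg : ∀ i, IsAlgebraic (Algebra.adjoin (algebraicClosure k Ω) (Set.range w))
      (algebraMap K Ω (x i)) := by
    intro i
    have h3 := hT3 i P hPL _ hPx hwE fun l hl => hin i l (by simp [hl])
    have h4 := hT4 i P hPL _ hPx hwE fun l hl => hin i l (by simp [hl])
    have h5 := Plc.R.of_mem h3
    exact (hT2 i P hPL w hRw (fun l hl => hin i l (by simp [hl])) _
      (h5.ne_zero_of_inv (hp0 i) h4) h5).2 _ (hPx i)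
  refine ⟨P, w, hPk, hPL, hPx, hRw, ?_⟩
  have hwE' : IsTranscendenceBasis (algebraicClosure k Ω) (algebraMap K Ω ∘ x) := by
    rw [isTranscendenceBasis_iff_algebraicIndependent_isAlgebraic]
    refine ⟨hwE, ⟨fun z => ?_⟩⟩
    refine isAlgebraic_of_range (R := Algebra.adjoin k (Set.range (algebraMap K Ω ∘ x))) ?_
      (hw.isAlgebraic.isAlgebraic z)
    intro r
    refine ⟨⟨r.1, ?_⟩, rfl⟩
    have h1 : Algebra.adjoin k (Set.range (algebraMap K Ω ∘ x)) ≤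
      (Algebra.adjoin (algebraicClosure k Ω) (Set.range (algebraMap K Ω ∘ x))).restrictScalars k :=
      Algebra.adjoin_le Algebra.subset_adjoin
    exact h1 r.2
  have : Algebra.IsAlgebraic (Algebra.adjoin (algebraicClosure k Ω) (Set.range w)) Ω :=
    hwE'.isAlgebraic_iff.mpr hxalg
  have h2 := (isTranscendenceBasis_equiv eqv).mpr hwE'
  exact (Algebra.IsAlgebraic.isTranscendenceBasis_of_lift_le_trdeg_of_finite _ w
    h2.lift_cardinalMk_eq_trdeg.le).1

end lemD

section lemD
open IntermediateField

/-- The image of a subfield under a place. -/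
def Plc.image {k L M Ω : Type*} [Field k] [Field L] [Field M] [Field Ω] [Algebra k L]
    [Algebra k M] [Algebra L M] [IsScalarTower k L M] [Algebra k Ω] (P : Plc M Ω)
    (hk : ∀ c : k, P.R (algebraMap k M c) (algebraMap k Ω c)) (B : IntermediateField L M) :
    IntermediateField k Ω where
  carrier := {b | ∃ a ∈ B, P.R a b}
  mul_mem' := by
    rintro b b' ⟨a, ha, h⟩ ⟨a', ha', h'⟩
    exact ⟨_, B.mul_mem ha ha', h.mul h'⟩
  add_mem' := by
    rintro b b' ⟨a, ha, h⟩ ⟨a', ha', h'⟩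
    exact ⟨_, B.add_mem ha ha', h.add h'⟩
  algebraMap_mem' := by
    intro c
    refine ⟨_, ?_, hk c⟩
    rw [IsScalarTower.algebraMap_apply k L M]
    exact B.algebraMap_mem _
  inv_mem' := by
    rintro b ⟨a, ha, h⟩
    by_cases hb : b = 0
    · subst hb; exact ⟨0, B.zero_mem, by simpa using P.R_zero⟩
    · exact ⟨_, B.inv_mem ha, h.inv hb⟩

theorem isAlgebraic_of_alg_sub {A k Ω : Type*} [CommRing A] [IsDomain A] [Field k] [Field Ω]
    [Algebra A Ω] [FaithfulSMul A Ω] [Algebra k Ω]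
    (B1 : IntermediateField k Ω) (h : ∀ b ∈ B1, IsAlgebraic A b) {t : Ω} (ht : IsAlgebraic B1 t) :
    IsAlgebraic A t := by
  have h1 : IsAlgebraic (Subalgebra.algebraicClosure A Ω) t :=
    isAlgebraic_of_range (fun b => ⟨⟨b.1, h b.1 b.2⟩, rfl⟩) ht
  exact h1.restrictScalars A

theorem dep_option {L M κ : Type*} [Field L] [Field M] [Algebra L M] (B : IntermediateField L M)
    (y : κ → B) (hy : IsTranscendenceBasis L y) (a : M) (ha : a ∈ B) :
    ¬ AlgebraicIndependent L (fun o : Option κ => o.elim a (fun i => (y i : M))) := by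
  intro hind
  have hyM : AlgebraicIndependent L (fun i => (y i : M)) :=
    hind.comp some (Option.some_injective κ)
  have h2 := (hyM.option_iff_transcendental a).mp hind
  apply h2
  have h3 := isAlgebraic_image B.val (Set.range y) (hy.isAlgebraic.isAlgebraic (⟨a, ha⟩ : B))
  refine isAlgebraic_of_range ?_ h3
  rintro ⟨r, hr⟩
  refine ⟨⟨r, ?_⟩, rfl⟩
  rw [← Set.range_comp] at hr
  exact hr

theorem lemD {k L K M Ω ι : Type*} [Field k] [Field L] [Field K] [Field M] [Field Ω]
    [Algebra k L] [Algebra k K] [Algebra k M] [Algebra L M] [Algebra K M] [IsScalarTower k L M]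
    [IsScalarTower k K M] [Algebra k Ω] [Algebra K Ω] [IsScalarTower k K Ω] [IsAlgClosed Ω]
    [Algebra.IsAlgebraic K Ω] [Finite ι] (x : ι → K) (hx : IsTranscendenceBasis k x)
    (hxM : IsTranscendenceBasis L (algebraMap K M ∘ x))
    (B : IntermediateField L M) (t : M) (ht : Transcendental B t) (e : ℕ)
    (hr : Module.rank B⟮t⟯ M ≤ e) : WeakDiag k K Ω e := by
  classical
  have hfin : Module.Finite B⟮t⟯ M := by
    rw [← Module.rank_lt_aleph0_iff]
    exact hr.trans_lt (Cardinal.natCast_lt_aleph0)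
  have halg : Algebra.IsAlgebraic B⟮t⟯ M := Algebra.IsAlgebraic.of_finite _ _
  obtain ⟨κ, y, hy⟩ := exists_isTranscendenceBasis' L B
  have hu := trbasis_option B t ht halg y hy
  obtain ⟨P, w, hPk, hPL, hPx, hPw, hw⟩ := exists_plc_data (k := k) (Ω := Ω) x hx hxM _ hu
  -- the pieces of `w`
  set E0 := algebraicClosure k Ω with hE0
  let t1 : Ω := w none
  let y1 : κ → Ω := fun i => w (some i)
  have htt : P.R t t1 := hPw none
  have hyy : ∀ i, P.R (y i : M) (y1 i) := fun i => hPw (some i)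
  have hw' : AlgebraicIndependent E0 (fun o : Option κ => o.elim t1 y1) := by
    convert hw with o
    cases o <;> rfl
  have hy1 : AlgebraicIndependent E0 y1 := hw.comp some (Option.some_injective κ)
  have ht1 : Transcendental (Algebra.adjoin E0 (Set.range y1)) t1 :=
    (hy1.option_iff_transcendental t1).mp hw'
  let B1 := P.image hPk B
  have hB1alg : ∀ b ∈ B1, IsAlgebraic (Algebra.adjoin E0 (Set.range y1)) b := by
    rintro b ⟨a, ha, hab⟩
    by_contra htr
    have h1 := (hy1.option_iff_transcendental b).mpr htr
    refine P.dep hPL (u := fun o : Option κ => o.elim a (fun i => (y i : M))) _ ?_ ?_ h1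
    · intro o
      cases o
      · exact hab
      · exact hyy _
    · exact dep_option B y hy a ha
  have htB1 : Transcendental B1 t1 := by
    intro hal
    exact ht1 (isAlgebraic_of_alg_sub B1 hB1alg hal)
  let C0 := P.image hPk (⊤ : IntermediateField L M)
  have hBC : B1 ≤ C0 := by
    rintro b ⟨a, -, hab⟩
    exact ⟨a, trivial, hab⟩
  have hBC2 : B1⟮t1⟯ ≤ extendScalars hBC := by
    rw [adjoin_simple_le_iff]
    exact ⟨t, trivial, htt⟩
  have hKV : ∀ a : K, algebraMap K M a ∈ P.V := by
    intro a
    have h1 := isAlgebraic_image (IsScalarTower.toAlgHom k K M) (Set.range x) (hx.isAlgebraic.isAlgebraic a)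
    rw [← Set.range_comp] at h1
    obtain ⟨T, hT⟩ := Plc.mem_of_good (k := k) (Ω := Ω) h1
    have hw : IsTranscendenceBasis k (algebraMap K Ω ∘ x) := hx.algebraMap_comp
    refine hT P ?_ _ hPx hw.1.algebraicClosure fun l _ => (hPk l).mem
    intro l b hb
    rw [hb.uniq (hPk l)]
    exact isAlgebraic_algebraMap l
  let f : K →ₐ[k] Ω :=
    { toFun := fun a => P.ψ ⟨algebraMap K M a, hKV a⟩
      map_one' := (Plc.R.of_mem (hKV 1)).uniq (by simpa using P.R_one)
      map_zero' := (Plc.R.of_mem (hKV 0)).uniq (by simpa using P.R_zero)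
      map_add' := fun a b => (Plc.R.of_mem (hKV (a + b))).uniq
        (by rw [map_add]; exact (Plc.R.of_mem (hKV a)).add (Plc.R.of_mem (hKV b)))
      map_mul' := fun a b => (Plc.R.of_mem (hKV (a * b))).uniq
        (by rw [map_mul]; exact (Plc.R.of_mem (hKV a)).mul (Plc.R.of_mem (hKV b)))
      commutes' := fun c => (Plc.R.of_mem (hKV (algebraMap k K c))).uniq
        (by rw [← IsScalarTower.algebraMap_apply]; exact hPk c) }
  have hfx : ∀ i, f (x i) = algebraMap K Ω (x i) := fun i => (Plc.R.of_mem (hKV (x i))).uniq (hPx i)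
  have hfint : f.toRingHom.IsIntegral := by
    have hw : IsTranscendenceBasis k (algebraMap K Ω ∘ x) := hx.algebraMap_comp
    have hw2 : (algebraMap K Ω ∘ x) = f ∘ x := by ext i; exact (hfx i).symm
    rw [hw2] at hw
    have := @IsTranscendenceBasis.isAlgebraic_iff k K Ω _ _ _ _ _ f.toRingHom.toAlgebra
      (@IsScalarTower.of_algebraMap_eq k K Ω _ _ _ _ f.toRingHom.toAlgebra _
        (fun c => (f.commutes c).symm)) _ _ _ _ hw
    have h2 := this.mpr fun i => by
      letI := f.toRingHom.toAlgebra
      exact isAlgebraic_algebraMap (x i)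
    intro z
    letI := f.toRingHom.toAlgebra
    exact (h2.isAlgebraic z).isIntegral
  refine ⟨B1, t1, extendScalars hBC2, f, htB1, hfint, ?_, ?_⟩
  · intro a
    exact ⟨_, trivial, Plc.R.of_mem (hKV a)⟩
  · refine P.rank_bound B t B1 (fun b hb c hc => ⟨b, hb, hc⟩) t1 htt htB1 _ ?_ e hr
    rintro c ⟨a, -, ha⟩
    exact ⟨a, ha⟩

end lemD

section lemA
open IntermediateField

/-- A finite span which is closed under multiplication is a field. -/
theorem span_field {F Ω : Type*} [Field F] [Field Ω] [Algebra F Ω] (n : ℕ) (b : Fin n → Ω)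
    (h1 : (1 : Ω) ∈ Submodule.span F (Set.range b))
    (hm : ∀ i j, b i * b j ∈ Submodule.span F (Set.range b)) :
    ∃ C : IntermediateField F Ω, (∀ z, z ∈ C ↔ z ∈ Submodule.span F (Set.range b)) ∧
      Module.rank F C ≤ n := by
  have hmul : ∀ x y, x ∈ Submodule.span F (Set.range b) → y ∈ Submodule.span F (Set.range b) →
      x * y ∈ Submodule.span F (Set.range b) := by
    intro x y hx hy
    have : Submodule.span F (Set.range b) * Submodule.span F (Set.range b) ≤
        Submodule.span F (Set.range b) := by
      rw [Submodule.span_mul_span, Submodule.span_le]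
      rintro _ ⟨_, ⟨i, rfl⟩, _, ⟨j, rfl⟩, rfl⟩
      exact hm i j
    exact this (Submodule.mul_mem_mul hx hy)
  let S : Subalgebra F Ω := (Submodule.span F (Set.range b)).toSubalgebra h1 hmul
  have hfin : Module.Finite F S := by
    have : Module.Finite F (Submodule.span F (Set.range b)) :=
      Module.Finite.span_of_finite F (Set.finite_range b)
    exact this
  have halg : Algebra.IsAlgebraic F S := Algebra.IsAlgebraic.of_finite F S
  let C : IntermediateField F Ω := S.toIntermediateField (by
    intro x hx
    exact S.inv_mem_of_algebraic (x := ⟨x, hx⟩)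
      ((halg.isAlgebraic (⟨x, hx⟩ : S)).algHom S.val))
  refine ⟨C, fun z => Iff.rfl, ?_⟩
  have h2 : Module.rank F C = Module.rank F (Submodule.span F (Set.range b)) := rfl
  rw [h2]
  have h3 := rank_span_finset_le (R := F) (Set.finite_range b).toFinset
  rw [Set.Finite.coe_toFinset] at h3
  refine h3.trans ?_
  have : (Set.finite_range b).toFinset.card ≤ n := by
    classical
    rw [Set.Finite.toFinset_range]
    simpa using Finset.card_image_le (s := Finset.univ) (f := b)
  exact_mod_cast this

theorem map_adjoin_simple {B M Ω : Type*} [Field B] [Field M] [Field Ω] [Algebra B M] (σ : M →+* Ω)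
    (t : M) (F' : Subfield Ω) (hB : ∀ b : B, σ (algebraMap B M b) ∈ F') (ht : σ t ∈ F')
    (c : M) (hc : c ∈ B⟮t⟯) : σ c ∈ F' := by
  have h1 : c ∈ Subfield.closure (Set.range (algebraMap B M) ∪ {t}) := hc
  have h2 : Subfield.closure (Set.range (algebraMap B M) ∪ {t}) ≤ F'.comap σ := by
    rw [Subfield.closure_le]
    rintro _ (⟨b, rfl⟩ | rfl)
    · exact hB b
    · exact ht
  exact h2 h1

/-- Elements of `B(t)` are defined over a finitely generated subfield of `B`. -/
theorem exists_fin_def {k Ω : Type*} [Field k] [Field Ω] [Algebra k Ω] (B : IntermediateField k Ω)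
    (t : Ω) (c : Ω) (hc : c ∈ B⟮t⟯) :
    ∃ S : Finset Ω, (∀ s ∈ S, s ∈ B) ∧ c ∈ IntermediateField.adjoin k ((S : Set Ω) ∪ {t}) := by
  classical
  have h1 : c ∈ IntermediateField.adjoin k ((B : Set Ω) ∪ {t}) := by
    refine map_adjoin_simple (RingHom.id Ω) t
      (IntermediateField.adjoin k ((B : Set Ω) ∪ {t})).toSubfield ?_ ?_ c hc
    · intro b
      exact subset_adjoin k _ (Or.inl b.2)
    · exact subset_adjoin k _ (Or.inr rfl)
  obtain ⟨T, hT, hcT⟩ := exists_finset_of_mem_adjoin h1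
  refine ⟨T.filter (· ∈ B), fun s hs => (Finset.mem_filter.mp hs).2, ?_⟩
  refine (adjoin.mono k _ _ ?_) hcT
  intro z hz
  rcases hT hz with h | h
  · exact Or.inl (by simpa using ⟨hz, h⟩)
  · exact Or.inr h

theorem finite_of_ess_integral {k K C : Type*} [Field k] [Field K] [Field C] [Algebra k K]
    [Algebra k C] (hC : IsAlgFunctionField k C) (f : K →ₐ[k] C) (hf : f.toRingHom.IsIntegral) :
    f.toRingHom.Finite := by
  letI := f.toRingHom.toAlgebra
  haveI : IsScalarTower k K C := IsScalarTower.of_algebraMap_eq fun c => (f.commutes c).symm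
  obtain ⟨s, hs⟩ := hC
  have htop : IntermediateField.adjoin K (s : Set C) = ⊤ := by
    rw [eq_top_iff]
    intro z _
    have hz : z ∈ IntermediateField.adjoin k (s : Set C) := by rw [hs]; trivial
    have h1 : IntermediateField.adjoin k (s : Set C) ≤
        (IntermediateField.adjoin K (s : Set C)).restrictScalars k :=
      adjoin_le_iff.mpr (subset_adjoin K _)
    exact h1 hz
  have hfd : FiniteDimensional K (IntermediateField.adjoin K (s : Set C)) :=
    IntermediateField.finiteDimensional_adjoin fun x _ => hf x
  rw [htop] at hfd
  have : Module.Finite K C := Module.Finite.equiv (IntermediateField.topEquiv (F := K) (E := C)).toLinearEquiv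
  exact this

end lemA

section lemA
open IntermediateField

/-- Abstract repackaging. -/
theorem diag_generic {k : Type u} {K : Type v} {B C : Type (max u v)} {F : Type*} [Field k] [Field K]
    [Field B] [Field C] [Field F] [Algebra k K] [Algebra k B] [Algebra k F] [Algebra k C] [Algebra B F]
    [Algebra F C] [IsScalarTower k B F] [IsScalarTower k F C] [Algebra.EssFiniteType k B]
    [Algebra.EssFiniteType B F] [Module.Finite F C] (ε : RatFunc B ≃ₐ[B] F) (f : K →ₐ[k] C)
    (hf : f.toRingHom.IsIntegral) : HasCvgDiagram k K (Module.finrank F C) := by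
  have h1 : Algebra.EssFiniteType k F := .comp k B F
  have h2 : Algebra.EssFiniteType k C := .comp k F C
  let π : RatFunc B →ₐ[k] C := (IsScalarTower.toAlgHom k F C).comp (ε.toAlgHom.restrictScalars k)
  refine ⟨B, C, inferInstance, inferInstance, inferInstance, inferInstance, fg_top k B, fg_top k C, f, π,
    finite_of_ess_integral (fg_top k C) f hf, ?_⟩
  letI := π.toRingHom.toAlgebra
  refine Algebra.finrank_eq_of_equiv_equiv ε.toRingEquiv (RingEquiv.refl C) ?_
  rfl

theorem integral_restrict {k K F Ω : Type*} [Field k] [Field K] [Field F] [Field Ω] [Algebra k K] [Algebra k F]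
    [Algebra F Ω] [Algebra k Ω] [IsScalarTower k F Ω] (C : IntermediateField F Ω) (f : K →ₐ[k] Ω)
    (hf : f.toRingHom.IsIntegral) (hfC : ∀ a, f a ∈ C) [Algebra k C] [IsScalarTower k F C] :
    ∃ f' : K →ₐ[k] C, f'.toRingHom.IsIntegral := by
  let f' : K →ₐ[k] C :=
    { toFun := fun a => ⟨f a, hfC a⟩
      map_one' := Subtype.ext (map_one f)
      map_zero' := Subtype.ext (map_zero f)
      map_add' := fun a b => Subtype.ext (map_add f a b)
      map_mul' := fun a b => Subtype.ext (map_mul f a b)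
      commutes' := fun c => Subtype.ext (by
        rw [IsScalarTower.algebraMap_apply k F C]
        change f (algebraMap k K c) = algebraMap F Ω (algebraMap k F c)
        rw [f.commutes, IsScalarTower.algebraMap_apply k F Ω]) }
  refine ⟨f', ?_⟩
  intro z
  obtain ⟨p, hp, hz⟩ := hf (z : Ω)
  refine ⟨p, hp, Subtype.ext ?_⟩
  have h3 : ((p.eval₂ f'.toRingHom z : C) : Ω) = p.eval₂ ((algebraMap C Ω).comp f'.toRingHom) (z : Ω) :=
    (Polynomial.hom_eval₂ p f'.toRingHom (algebraMap C Ω) z)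
  rw [h3]
  exact hz

/-- Repackaging: subfields of `Ω` giving a diagram. -/
theorem diag_of_subfields {k : Type u} {K : Type v} {Ω : Type (max u v)} [Field k] [Field K] [Field Ω]
    [Algebra k K] [Algebra k Ω] (B : IntermediateField k Ω) (hB : B.FG) (t : Ω) (ht : Transcendental B t)
    (C : IntermediateField B⟮t⟯ Ω) (hC : Module.Finite B⟮t⟯ C) (f : K →ₐ[k] Ω)
    (hf : f.toRingHom.IsIntegral) (hfC : ∀ a, f a ∈ C) :
    HasCvgDiagram k K (Module.finrank B⟮t⟯ C) := by
  have hBess : Algebra.EssFiniteType k B := essFiniteType_iff.mpr hB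
  have hFess : Algebra.EssFiniteType B B⟮t⟯ := essFiniteType_iff.mpr ⟨{t}, by simp⟩
  haveI : IsScalarTower k B⟮t⟯ Ω := IsScalarTower.of_algebraMap_eq fun c => rfl
  letI : Algebra k C := ((algebraMap B⟮t⟯ C).comp (algebraMap k B⟮t⟯)).toAlgebra
  haveI : IsScalarTower k B⟮t⟯ C := IsScalarTower.of_algebraMap_eq fun c => rfl
  obtain ⟨f', hf'⟩ := integral_restrict C f hf hfC
  exact diag_generic (RatFunc.algEquivOfTranscendental t ht) f' hf'

theorem basis_generic {F Ω : Type*} [Field F] [Field Ω] [Algebra F Ω] (C : IntermediateField F Ω) (e : ℕ)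
    (hr : Module.rank F C ≤ e) : ∃ n ≤ e, ∃ b : Fin n → Ω, (∀ i, b i ∈ C) ∧
      ∃ r : Ω → Fin n → F, ∀ z ∈ C, z = ∑ i, algebraMap F Ω (r z i) * b i := by
  classical
  have hfin : Module.Finite F C := by
    rw [← Module.rank_lt_aleph0_iff]
    exact hr.trans_lt (Cardinal.natCast_lt_aleph0)
  rw [← Module.finrank_eq_rank] at hr
  let b := Module.finBasis F C
  refine ⟨_, by exact_mod_cast hr, fun i => b i, fun i => (b i).2,
    fun z => if hz : z ∈ C then b.repr ⟨z, hz⟩ else 0, fun z hz => ?_⟩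
  have h1 := congrArg C.val (b.sum_repr ⟨z, hz⟩)
  rw [map_sum] at h1
  simp only [dif_pos hz]
  refine h1.symm.trans (Finset.sum_congr rfl fun i _ => ?_)
  rw [map_smul, Algebra.smul_def]
  rfl

theorem rank_generic {F Ω : Type*} [Field F] [Field Ω] [Algebra F Ω] (C : IntermediateField F Ω) (e : ℕ)
    (hr : Module.rank F C ≤ e) :
    Module.Finite F C ∧ 0 < Module.finrank F C ∧ Module.finrank F C ≤ e := by
  have hfin : Module.Finite F C := by
    rw [← Module.rank_lt_aleph0_iff]
    exact hr.trans_lt (Cardinal.natCast_lt_aleph0)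
  rw [← Module.finrank_eq_rank] at hr
  exact ⟨hfin, Module.finrank_pos, by exact_mod_cast hr⟩

theorem lemA {k : Type u} {K : Type v} {Ω : Type (max u v)} [Field k] [Field K] [Field Ω]
    [Algebra k K] [Algebra k Ω] (hK : IsAlgFunctionField k K) (e : ℕ) (h : WeakDiag k K Ω e) :
    ∃ e', 0 < e' ∧ e' ≤ e ∧ HasCvgDiagram k K e' := by
  classical
  obtain ⟨B, t, C, f, ht, hf, hfC, hr⟩ := h
  obtain ⟨n, hne, b, hbC, r, hrep⟩ := basis_generic C e hr
  obtain ⟨G, hG⟩ := hK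
  let Z : Finset Ω := insert 1 ((Finset.univ.image fun q : Fin n × Fin n => b q.1 * b q.2) ∪
    G.image f)
  have hZC : ∀ z ∈ Z, z ∈ C := by
    intro z hz
    rcases Finset.mem_insert.mp hz with rfl | hz
    · exact C.one_mem
    rcases Finset.mem_union.mp hz with hz | hz
    · obtain ⟨q, -, rfl⟩ := Finset.mem_image.mp hz
      exact C.mul_mem (hbC _) (hbC _)
    · obtain ⟨q, -, rfl⟩ := Finset.mem_image.mp hz
      exact hfC q
  choose S hS1 hS2 using fun c : B⟮t⟯ => exists_fin_def B t c c.2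
  let T : Finset Ω := Z.biUnion fun z => Finset.univ.biUnion fun i => S (r z i)
  have hTB : ∀ s ∈ T, s ∈ B := by
    intro s hs
    obtain ⟨z, -, hs⟩ := Finset.mem_biUnion.mp hs
    obtain ⟨i, -, hs⟩ := Finset.mem_biUnion.mp hs
    exact hS1 _ s hs
  let B2 : IntermediateField k Ω := IntermediateField.adjoin k (T : Set Ω)
  have hB2 : B2 ≤ B := adjoin_le_iff.mpr hTB
  have ht2 : Transcendental B2 t := fun h => ht (isAlgebraic_of_range (fun r => ⟨⟨r.1, hB2 r.2⟩, rfl⟩) h)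
  have hZ : ∀ z ∈ Z, z ∈ Submodule.span B2⟮t⟯ (Set.range b) := by
    intro z hz
    rw [hrep z (hZC z hz)]
    refine Submodule.sum_mem _ fun i _ => ?_
    have hmem : ((r z i : B⟮t⟯) : Ω) ∈ B2⟮t⟯ := by
      have h2 : IntermediateField.adjoin k ((S (r z i) : Set Ω) ∪ {t}) ≤ B2⟮t⟯.restrictScalars k := by
        rw [adjoin_le_iff]
        rintro s (hs | hs)
        · have : s ∈ B2 := subset_adjoin k _ (Finset.mem_biUnion.mpr ⟨z, hz, Finset.mem_biUnion.mpr
            ⟨i, Finset.mem_univ _, hs⟩⟩)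
          exact B2⟮t⟯.algebraMap_mem ⟨s, this⟩
        · rw [Set.mem_singleton_iff.mp hs]
          exact mem_adjoin_simple_self B2 t
      exact h2 (hS2 _)
    exact Submodule.smul_mem _ (⟨_, hmem⟩ : B2⟮t⟯) (Submodule.subset_span ⟨i, rfl⟩)
  obtain ⟨C2, hC2, hrk⟩ := span_field n b (hZ 1 (by simp [Z])) (fun i j => hZ (b i * b j) (by
    refine Finset.mem_insert_of_mem (Finset.mem_union_left _ ?_)
    exact Finset.mem_image.mpr ⟨(i, j), Finset.mem_univ _, rfl⟩))
  have hfC2 : ∀ a, f a ∈ C2 := by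
    intro a
    have ha : a ∈ IntermediateField.adjoin k (G : Set K) := by rw [hG]; trivial
    have h1 : a ∈ Subfield.closure (Set.range (algebraMap k K) ∪ G) := ha
    have h3 : Subfield.closure (Set.range (algebraMap k K) ∪ G) ≤ C2.toSubfield.comap f.toRingHom := by
      rw [Subfield.closure_le]
      rintro g (⟨c, rfl⟩ | hg)
      · have : f (algebraMap k K c) = algebraMap B2⟮t⟯ Ω (algebraMap k B2⟮t⟯ c) := f.commutes c
        change f (algebraMap k K c) ∈ C2
        rw [this]
        exact C2.algebraMap_mem _
      · refine (hC2 _).mpr (hZ (f g) ?_)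
        refine Finset.mem_insert_of_mem (Finset.mem_union_right _ ?_)
        exact Finset.mem_image.mpr ⟨g, hg, rfl⟩
    exact h3 h1
  obtain ⟨hfin2, hpos, hle⟩ := rank_generic C2 n hrk
  exact ⟨_, hpos, hle.trans hne, diag_of_subfields B2 ⟨T, rfl⟩ t ht2 C2 hfin2 f hf hfC2⟩

end lemA

section lemI
open IntermediateField

theorem rank_le_of_sub {R M : Type*} [Field R] [Field M] {F : Type*} [Field F] [Algebra R M] [Algebra F M] (e : ℕ)
    (he : 0 < e) (h : Module.finrank R M = e)
    (hF : ∀ r : R, ∃ s : F, algebraMap F M s = algebraMap R M r) : Module.rank F M ≤ e := by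
  choose g hg using hF
  let φ : R →+* F :=
    { toFun := g
      map_one' := (algebraMap F M).injective (by simp [hg])
      map_zero' := (algebraMap F M).injective (by simp [hg])
      map_add' := fun a b => (algebraMap F M).injective (by simp [hg])
      map_mul' := fun a b => (algebraMap F M).injective (by simp [hg]) }
  letI := φ.toAlgebra
  haveI : IsScalarTower R F M := IsScalarTower.of_algebraMap_eq fun r => (hg r).symm
  haveI : Module.Finite R M := Module.finite_of_finrank_pos (h ▸ he)
  haveI : Module.Finite F M := Module.Finite.of_restrictScalars_finite R F M
  rw [← Module.finrank_eq_rank]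
  have := Module.finrank_mul_finrank R F M
  rw [h] at this
  exact_mod_cast Nat.le_of_dvd he ⟨_, (mul_comm _ _).trans this |>.symm⟩

theorem lemI {k : Type u} {K : Type v} [Field k] [Field K] [Algebra k K] (e : ℕ) (he : 0 < e)
    (h : HasCvgDiagram k K e) :
    ∃ (M : Type (max u v)) (_ : Field M) (_ : Algebra k M) (f : K →ₐ[k] M) (B : IntermediateField k M)
      (t : M), f.toRingHom.IsIntegral ∧ Transcendental B t ∧ Module.rank B⟮t⟯ M ≤ e := by
  obtain ⟨K_B, M, _, _, _, _, hB, hM, f, π, hf, hfin⟩ := h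
  let g : K_B →ₐ[k] M := π.comp (IsScalarTower.toAlgHom k K_B (RatFunc K_B))
  have hgB : ∀ b : g.fieldRange, ∃ c : K_B, g c = b := fun b => b.2
  have hgx : ∀ b : K_B, g b = π (RatFunc.C b) := fun b => rfl
  refine ⟨M, inferInstance, inferInstance, f, g.fieldRange, π RatFunc.X, hf.to_isIntegral, ?_, ?_⟩
  · intro halg
    letI := g.toRingHom.toAlgebra
    have h1 : IsAlgebraic K_B (π RatFunc.X) := isAlgebraic_of_range hgB halg
    obtain ⟨p, hp, hpx⟩ := h1
    apply hp
    have h2 : Polynomial.aeval (π RatFunc.X) p = π (algebraMap _ _ p) := by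
      rw [Polynomial.aeval_def, ← RatFunc.aeval_X_left_eq_algebraMap p, Polynomial.aeval_def]
      exact (Polynomial.hom_eval₂ p _ π.toRingHom _).symm
    rw [h2] at hpx
    have h3 := (map_eq_zero π).mp hpx
    exact (map_eq_zero_iff _ (RatFunc.algebraMap_injective K_B)).mp h3
  · letI := π.toRingHom.toAlgebra
    refine rank_le_of_sub (R := RatFunc K_B) e he hfin fun r => ?_
    have hp : ∀ p : Polynomial K_B, π (algebraMap _ _ p) ∈ (g.fieldRange)⟮π RatFunc.X⟯ := by
      intro p
      induction p using Polynomial.induction_on' with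
      | add p q hp hq => rw [map_add, map_add]; exact add_mem hp hq
      | monomial n a =>
        rw [← Polynomial.C_mul_X_pow_eq_monomial, map_mul, map_mul, map_pow, map_pow, RatFunc.algebraMap_X,
          RatFunc.algebraMap_C, ← hgx]
        refine mul_mem ?_ (pow_mem (mem_adjoin_simple_self _ _) _)
        exact IntermediateField.algebraMap_mem _ (⟨g a, a, rfl⟩ : g.fieldRange)
    refine ⟨⟨π r, ?_⟩, rfl⟩
    rw [← RatFunc.num_div_denom r, map_div₀]
    exact div_mem (hp _) (hp _)

end lemI

section lemC
open IntermediateField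

theorem span_of_basis {F M F' Ω : Type*} [Field F] [Field M] [Field F'] [Field Ω] [Algebra F M] [Algebra F' Ω]
    (σ : M →+* Ω) (hσ : ∀ c : F, ∃ c' : F', algebraMap F' Ω c' = σ (algebraMap F M c)) (e : ℕ)
    (hr : Module.rank F M ≤ e) :
    ∃ C : IntermediateField F' Ω, (∀ m, σ m ∈ C) ∧ Module.rank F' C ≤ e := by
  have hfin : Module.Finite F M := by
    rw [← Module.rank_lt_aleph0_iff]
    exact hr.trans_lt (Cardinal.natCast_lt_aleph0)
  rw [← Module.finrank_eq_rank] at hr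
  let b := Module.finBasis F M
  have hm : ∀ m, σ m ∈ Submodule.span F' (Set.range fun i => σ (b i)) := by
    intro m
    rw [← b.sum_repr m, map_sum]
    refine Submodule.sum_mem _ fun i _ => ?_
    obtain ⟨c', hc'⟩ := hσ (b.repr m i)
    rw [Algebra.smul_def, map_mul, ← hc', ← Algebra.smul_def]
    exact Submodule.smul_mem _ _ (Submodule.subset_span ⟨i, rfl⟩)
  obtain ⟨C, hC, hrk⟩ := span_field (F := F') _ (fun i => σ (b i)) (by simpa using hm 1)
    (fun i j => by rw [← map_mul]; exact hm _)
  exact ⟨C, fun m => (hC _).mpr (hm m), hrk.trans (by exact_mod_cast hr)⟩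

theorem lemC_core {k L M Ω ι : Type*} [Field k] [Field L] [Field M] [Field Ω] [Algebra k L] [Algebra k M]
    [Algebra k Ω] [Algebra L Ω] [IsScalarTower k L Ω] [Finite ι] (σ : M →ₐ[k] Ω) (z : ι → M)
    (hz : IsTranscendenceBasis k z) (hσz : IsTranscendenceBasis L (σ ∘ z))
    (B : IntermediateField k M) (t : M) (ht : Transcendental B t) (e : ℕ)
    (hr : Module.rank B⟮t⟯ M ≤ e) :
    ∃ (B' : IntermediateField L Ω) (t' : Ω) (C' : IntermediateField B'⟮t'⟯ Ω), Transcendental B' t' ∧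
      (∀ m, σ m ∈ C') ∧ Module.rank B'⟮t'⟯ C' ≤ e := by
  classical
  have hfin : Module.Finite B⟮t⟯ M := by
    rw [← Module.rank_lt_aleph0_iff]
    exact hr.trans_lt (Cardinal.natCast_lt_aleph0)
  have halg : Algebra.IsAlgebraic B⟮t⟯ M := Algebra.IsAlgebraic.of_finite _ _
  obtain ⟨κ, y, hy⟩ := exists_isTranscendenceBasis' k B
  have hu := trbasis_option B t ht halg y hy
  set u := (fun o : Option κ => o.elim t (fun i => (y i : M))) with hudef
  obtain ⟨eqv⟩ := Cardinal.lift_mk_eq'.mp (hu.lift_cardinalMk_eq hz)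
  have : Finite (Option κ) := Finite.of_equiv _ eqv.symm
  have : Fintype (Option κ) := Fintype.ofFinite _
  -- transfer of algebraicity
  have htrans : ∀ (s : Set M) (a : M), IsAlgebraic (Algebra.adjoin k s) a →
      IsAlgebraic (Algebra.adjoin L (σ '' s)) (σ a) := by
    intro s a ha
    refine isAlgebraic_of_range ?_ (isAlgebraic_image σ s ha)
    intro r
    refine ⟨⟨r.1, ?_⟩, rfl⟩
    have h1 : Algebra.adjoin k (σ '' s) ≤ (Algebra.adjoin L (σ '' s)).restrictScalars k :=
      Algebra.adjoin_le Algebra.subset_adjoin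
    exact h1 r.2
  have hΩ : Algebra.IsAlgebraic (Algebra.adjoin L (Set.range (σ ∘ u))) Ω := by
    refine hσz.isAlgebraic_iff.mpr fun i => ?_
    rw [Set.range_comp]
    exact htrans _ _ (hu.isAlgebraic.isAlgebraic _)
  have h2 := (isTranscendenceBasis_equiv eqv).mpr hσz
  have hσu : AlgebraicIndependent L (σ ∘ u) :=
    (Algebra.IsAlgebraic.isTranscendenceBasis_of_lift_le_trdeg_of_finite _ (σ ∘ u)
      h2.lift_cardinalMk_eq_trdeg.le).1
  have hσy : AlgebraicIndependent L (fun i => σ (y i)) := hσu.comp some (Option.some_injective κ)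
  have hσt : Transcendental (Algebra.adjoin L (Set.range fun i => σ (y i))) (σ t) := by
    refine (hσy.option_iff_transcendental (σ t)).mp ?_
    convert hσu with o
    cases o <;> rfl
  let B' : IntermediateField L Ω := IntermediateField.adjoin L (σ '' B)
  let AY := Algebra.adjoin L (Set.range fun i => σ (y i))
  have hB'alg : ∀ b ∈ B', IsAlgebraic AY b := by
    intro b hb
    induction hb using IntermediateField.adjoin_induction with
    | mem b hb =>
      obtain ⟨a, ha, rfl⟩ := hb
      have h3 := isAlgebraic_image B.val (Set.range y) (hy.isAlgebraic.isAlgebraic (⟨a, ha⟩ : B))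
      rw [← Set.range_comp] at h3
      have h4 := htrans _ _ h3
      rw [← Set.range_comp] at h4
      exact h4
    | algebraMap c => exact isAlgebraic_algebraMap (R := AY) (A := Ω) (algebraMap L AY c)
    | add a b _ _ ha hb => exact ha.add hb
    | inv a _ ha => exact ha.inv
    | mul a b _ _ ha hb => exact ha.mul hb
  refine ⟨B', σ t, ?_⟩
  have hmem : ∀ c : B⟮t⟯, ∃ c' : B'⟮σ t⟯, algebraMap B'⟮σ t⟯ Ω c' = σ (algebraMap B⟮t⟯ M c) := by
    intro c
    refine ⟨⟨σ c, ?_⟩, rfl⟩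
    refine map_adjoin_simple σ.toRingHom t (B'⟮σ t⟯).toSubfield ?_ (mem_adjoin_simple_self _ _) c c.2
    intro b
    have : σ (algebraMap B M b) ∈ B' := subset_adjoin L _ ⟨b, b.2, rfl⟩
    exact IntermediateField.algebraMap_mem B'⟮σ t⟯ (⟨_, this⟩ : B')
  obtain ⟨C, h1, h2⟩ := span_of_basis σ.toRingHom hmem e hr
  exact ⟨C, fun h => hσt (isAlgebraic_of_alg_sub B' hB'alg h), h1, h2⟩

theorem lemC {k L K K' M Ω ι : Type*} [Field k] [Field L] [Field K] [Field K'] [Field M] [Field Ω]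
    [Algebra k L] [Algebra k K] [Algebra k M] [Algebra L K'] [Algebra k K'] [Algebra K K']
    [IsScalarTower k L K'] [IsScalarTower k K K'] [Algebra K' Ω] [Algebra.IsAlgebraic K' Ω]
    [Algebra k Ω] [Algebra L Ω] [IsScalarTower L K' Ω] [IsScalarTower k K' Ω]
    [IsAlgClosed Ω] [Finite ι] (x : ι → K) (hx : IsTranscendenceBasis k x)
    (hx' : IsTranscendenceBasis L (algebraMap K K' ∘ x))
    (hgen : IntermediateField.adjoin L (Set.range (algebraMap K K')) = ⊤)
    (f : K →ₐ[k] M) (hf : f.toRingHom.IsIntegral)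
    (B : IntermediateField k M) (t : M) (ht : Transcendental B t) (e : ℕ)
    (hr : Module.rank B⟮t⟯ M ≤ e) : WeakDiag L K' Ω e := by
  letI : Algebra K M := f.toRingHom.toAlgebra
  letI : Algebra K Ω := ((algebraMap K' Ω).comp (algebraMap K K')).toAlgebra
  haveI : IsScalarTower K K' Ω := IsScalarTower.of_algebraMap_eq fun c => rfl
  haveI : IsScalarTower k K Ω := IsScalarTower.of_algebraMap_eq fun c => by
    rw [IsScalarTower.algebraMap_apply K K' Ω, ← IsScalarTower.algebraMap_apply k K K',
      ← IsScalarTower.algebraMap_apply k K' Ω]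
  haveI : IsScalarTower k K M := IsScalarTower.of_algebraMap_eq fun c => (f.commutes c).symm
  haveI : IsScalarTower k L Ω := IsScalarTower.of_algebraMap_eq fun c => by
    rw [IsScalarTower.algebraMap_apply L K' Ω, ← IsScalarTower.algebraMap_apply k L K',
      ← IsScalarTower.algebraMap_apply k K' Ω]
  haveI : Algebra.IsIntegral K M := ⟨hf⟩
  haveI : Algebra.IsAlgebraic K M := inferInstance
  let σ0 : M →ₐ[K] Ω := IsAlgClosed.lift
  have hσ : ∀ a, σ0 (algebraMap K M a) = algebraMap K' Ω (algebraMap K K' a) := fun a => σ0.commutes a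
  have hz : IsTranscendenceBasis k (algebraMap K M ∘ x) := hx.algebraMap_comp
  have hz' : IsTranscendenceBasis L (algebraMap K' Ω ∘ (algebraMap K K' ∘ x)) := hx'.algebraMap_comp
  obtain ⟨B', t', C', h1, h2, h3⟩ := lemC_core (L := L) (σ0.restrictScalars k) _ hz (by
    convert hz' using 1
    ext i
    exact hσ (x i)) B t ht e hr
  refine ⟨B', t', C', IsScalarTower.toAlgHom L K' Ω, h1, ?_, ?_, h3⟩
  · intro w
    exact (Algebra.IsAlgebraic.isAlgebraic (R := K') w).isIntegral
  · intro a
    have ha : a ∈ IntermediateField.adjoin L (Set.range (algebraMap K K')) := by rw [hgen]; trivial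
    have ha1 : a ∈ Subfield.closure (Set.range (algebraMap L K') ∪ Set.range (algebraMap K K')) := ha
    have h4 : Subfield.closure (Set.range (algebraMap L K') ∪ Set.range (algebraMap K K')) ≤
        C'.toSubfield.comap (algebraMap K' Ω) := by
      rw [Subfield.closure_le]
      rintro g (⟨c, rfl⟩ | ⟨c, rfl⟩)
      · change algebraMap K' Ω (algebraMap L K' c) ∈ C'
        rw [← IsScalarTower.algebraMap_apply L K' Ω]
        exact C'.algebraMap_mem (algebraMap B' B'⟮t'⟯ (algebraMap L B' c))
      · change algebraMap K' Ω (algebraMap K K' c) ∈ C'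
        rw [← hσ]
        exact h2 _
    exact h4 ha1

end lemC

section lemH
open IntermediateField TensorProduct

theorem flat_domain_field {A K : Type*} [CommRing A] [IsDomain A] [Field K] (f : A →+* K)
    (hf : Function.Injective f) : f.Flat := by
  letI := f.toAlgebra
  haveI : FaithfulSMul A K := (faithfulSMul_iff_algebraMap_injective A K).mpr hf
  letI := FractionRing.liftAlgebra A K
  haveI : Module.Flat A (FractionRing A) := IsLocalization.flat _ (nonZeroDivisors A)
  have : Module.Flat A K := Module.Flat.trans A (FractionRing A) K
  exact this

theorem indep_tensor {k K L K' ι : Type*} [Field k] [Field K] [Field L] [Field K'] [Algebra k K] [Algebra k L]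
    [Algebra L K'] (g : K ⊗[k] L →+* K') (hgL : ∀ l, g (1 ⊗ₜ l) = algebraMap L K' l)
    (hg : ∀ z ∈ nonZeroDivisors (K ⊗[k] L), g z ≠ 0) (x : ι → K) (hx : AlgebraicIndependent k x) :
    AlgebraicIndependent L (fun i => g (x i ⊗ₜ 1)) := by
  let f : MvPolynomial ι k →ₐ[k] K := MvPolynomial.aeval x
  have hflat : f.toRingHom.Flat := flat_domain_field _ hx
  let ψ : L ⊗[k] MvPolynomial ι k →ₐ[L] L ⊗[k] K := Algebra.TensorProduct.map (AlgHom.id L L) f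
  have hψ : ψ.toRingHom.Flat := RingHom.Flat.tensorProductMap (.of_bijective Function.bijective_id) hflat
  let θ := MvPolynomial.algebraTensorAlgEquiv (σ := ι) k L
  let γ : MvPolynomial ι L →+* K' := g.comp ((Algebra.TensorProduct.comm k L K).toRingEquiv.toRingHom.comp
    (ψ.toRingHom.comp θ.symm.toRingEquiv.toRingHom))
  have hγ : ∀ q, MvPolynomial.aeval (fun i => g (x i ⊗ₜ 1)) q = γ q := by
    intro q
    induction q using MvPolynomial.induction_on with
    | C a =>
      have h1 : θ.symm (MvPolynomial.C a) = a ⊗ₜ 1 := θ.symm.commutes a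
      simp [γ, ψ, h1, hgL]
    | add p q hp hq => rw [map_add, map_add, hp, hq]
    | mul_X p i hp =>
      rw [map_mul, map_mul, hp]
      congr 1
      simp [γ, ψ, θ, f]
  have hinj : ∀ q, q ≠ 0 → γ q ≠ 0 := by
    intro q hq
    have h1 : θ.symm q ≠ 0 := by simpa using hq
    haveI : IsDomain (L ⊗[k] MvPolynomial ι k) := θ.toRingEquiv.toMulEquiv.isDomain _
    refine hg _ ?_
    letI := ψ.toRingHom.toAlgebra
    haveI : Module.Flat (L ⊗[k] MvPolynomial ι k) (L ⊗[k] K) := hψ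
    have h2 : IsSMulRegular (L ⊗[k] K) (θ.symm q) :=
      Module.Flat.isSMulRegular_of_nonZeroDivisors (mem_nonZeroDivisors_of_ne_zero h1)
    rw [mem_nonZeroDivisors_iff_right]
    intro z hz
    have h3 := congrArg (Algebra.TensorProduct.comm k L K).symm hz
    rw [map_mul, map_zero] at h3
    have h4 : θ.symm q • ((Algebra.TensorProduct.comm k L K).symm z) = 0 := by
      rw [Algebra.smul_def, mul_comm]
      refine Eq.trans ?_ h3
      congr 1
      exact ((Algebra.TensorProduct.comm k L K).symm_apply_apply _).symm
    have h5 := h2 (h4.trans (smul_zero _).symm)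
    simpa using h5
  rw [algebraicIndependent_iff]
  intro q hq
  by_contra hne
  exact hinj q hne ((hγ q).symm.trans hq)

theorem gen_tensor {k K L K' : Type*} [Field k] [Field K] [Field L] [Field K'] [Algebra k K] [Algebra k L]
    [Algebra L K'] (g : K ⊗[k] L →+* K') (hgL : ∀ l, g (1 ⊗ₜ l) = algebraMap L K' l)
    (hdiv : ∀ z, ∃ a b, z = g a / g b) :
    IntermediateField.adjoin L (Set.range fun a : K => g (a ⊗ₜ 1)) = ⊤ := by
  rw [eq_top_iff]
  intro z _
  have h : ∀ a, g a ∈ IntermediateField.adjoin L (Set.range fun a : K => g (a ⊗ₜ 1)) := by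
    intro a
    induction a using TensorProduct.induction_on with
    | zero => rw [map_zero]; exact zero_mem _
    | tmul a l =>
      rw [show a ⊗ₜ[k] l = (a ⊗ₜ 1) * (1 ⊗ₜ l) by simp, map_mul, hgL]
      exact mul_mem (subset_adjoin L _ ⟨a, rfl⟩) (IntermediateField.algebraMap_mem _ l)
    | add a b ha hb => rw [map_add]; exact add_mem ha hb
  obtain ⟨a, b, rfl⟩ := hdiv z
  exact div_mem (h a) (h b)

theorem exists_fin_trbasis {k K : Type*} [Field k] [Field K] [Algebra k K] (hK : IsAlgFunctionField k K) :
    ∃ (s : Set K), Finite s ∧ IsTranscendenceBasis k ((↑) : s → K) := by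
  haveI : Algebra.EssFiniteType k K := fg_top_iff.mp hK
  obtain ⟨s, hs⟩ := exists_isTranscendenceBasis k K
  exact ⟨s, Cardinal.lt_aleph0_iff_set_finite.1 (hs.cardinalMk_eq_trdeg.trans_lt (trdeg_lt_aleph0 k K)), hs⟩

/-- The extended transcendence basis. -/
theorem trbasis_ext {k K L K' ι : Type*} [Field k] [Field K] [Field L] [Field K'] [Algebra k K] [Algebra k L]
    [Algebra L K'] [Algebra k K'] [Algebra K K'] [IsScalarTower k L K'] [IsScalarTower k K K'] (x : ι → K)
    (hx : IsTranscendenceBasis k x) (hind : AlgebraicIndependent L (algebraMap K K' ∘ x))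
    (hgen : IntermediateField.adjoin L (Set.range (algebraMap K K')) = ⊤) :
    IsTranscendenceBasis L (algebraMap K K' ∘ x) := by
  rw [isTranscendenceBasis_iff_algebraicIndependent_isAlgebraic]
  refine ⟨hind, ⟨fun z => ?_⟩⟩
  let AY := Algebra.adjoin L (Set.range (algebraMap K K' ∘ x))
  have hz : z ∈ IntermediateField.adjoin L (Set.range (algebraMap K K')) := by rw [hgen]; trivial
  induction hz using IntermediateField.adjoin_induction with
  | mem b hb =>
    obtain ⟨a, rfl⟩ := hb
    have h3 := isAlgebraic_image (IsScalarTower.toAlgHom k K K') (Set.range x) (hx.isAlgebraic.isAlgebraic a)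
    rw [← Set.range_comp] at h3
    refine isAlgebraic_of_range ?_ h3
    intro r
    refine ⟨⟨r.1, ?_⟩, rfl⟩
    have h1 : Algebra.adjoin k (Set.range (IsScalarTower.toAlgHom k K K' ∘ x)) ≤
        AY.restrictScalars k := Algebra.adjoin_le Algebra.subset_adjoin
    exact h1 r.2
  | algebraMap c => exact isAlgebraic_algebraMap (R := AY) (A := K') (algebraMap L AY c)
  | add a b _ _ ha hb => exact ha.add hb
  | inv a _ ha => exact ha.inv
  | mul a b _ _ ha hb => exact ha.mul hb

theorem fg_ext {k K L K' : Type*} [Field k] [Field K] [Field L] [Field K'] [Algebra k K] [Algebra k L]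
    [Algebra L K'] [Algebra k K'] [Algebra K K'] [IsScalarTower k L K'] [IsScalarTower k K K']
    (hK : IsAlgFunctionField k K)
    (hgen : IntermediateField.adjoin L (Set.range (algebraMap K K')) = ⊤) :
    IsAlgFunctionField L K' := by
  classical
  obtain ⟨G, hG⟩ := hK
  refine ⟨G.image (algebraMap K K'), ?_⟩
  rw [eq_top_iff, ← hgen, adjoin_le_iff]
  rintro _ ⟨a, rfl⟩
  have ha : a ∈ IntermediateField.adjoin k (G : Set K) := by rw [hG]; trivial
  have h1 : IntermediateField.adjoin k (G : Set K) ≤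
      ((IntermediateField.adjoin L ((G.image (algebraMap K K') : Finset K') : Set K')).restrictScalars k).comap
        (IsScalarTower.toAlgHom k K K') := by
    rw [adjoin_le_iff]
    intro g hg
    exact subset_adjoin L _ (Finset.mem_coe.mpr (Finset.mem_image_of_mem _ hg))
  exact h1 ha

end lemH

section final
open IntermediateField TensorProduct
universe w w'

theorem sInf_eq_of_dom (S T : Set ℕ) (h1 : ∀ e ∈ S, ∃ e' ∈ T, e' ≤ e) (h2 : ∀ e ∈ T, ∃ e' ∈ S, e' ≤ e) :
    sInf S = sInf T := by
  have key : ∀ S T : Set ℕ, (∀ e ∈ S, ∃ e' ∈ T, e' ≤ e) → S.Nonempty → sInf T ≤ sInf S := by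
    intro S T h hS
    obtain ⟨e', he', hle⟩ := h _ (Nat.sInf_mem hS)
    exact (Nat.sInf_le he').trans hle
  rcases S.eq_empty_or_nonempty with rfl | hS
  · rcases T.eq_empty_or_nonempty with rfl | ⟨e, he⟩
    · rfl
    · obtain ⟨e', he', -⟩ := h2 e he
      exact absurd he' (Set.notMem_empty _)
  · obtain ⟨e, he⟩ := hS
    obtain ⟨e', he', -⟩ := h1 e he
    exact le_antisymm (key T S h2 ⟨e', he'⟩) (key S T h1 ⟨e, he⟩)

theorem exists_closure (_k : Type u) (K : Type v) [Field K] : ∃ (Ω : Type (max u v)) (_ : Field Ω) (_ : Algebra K Ω),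
    IsAlgClosed Ω ∧ Algebra.IsAlgebraic K Ω := by
  let Ω := AlgebraicClosure (ULift.{u} K)
  letI : Algebra K Ω :=
    ((algebraMap (ULift.{u} K) Ω).comp (ULift.ringEquiv (R := K)).symm.toRingHom).toAlgebra
  refine ⟨Ω, inferInstance, inferInstance, inferInstance, ⟨fun z => ?_⟩⟩
  exact isAlgebraic_of_range (R := ULift.{u} K) (fun r => ⟨r.down, rfl⟩) (Algebra.IsAlgebraic.isAlgebraic z)

theorem cvg_core (k : Type u) (K : Type v) (L : Type w) (K' : Type w') [Field k] [Field K] [Field L] [Field K']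
    [Algebra k K] [Algebra k L] [Algebra L K'] (hK : IsAlgFunctionField k K) (g : K ⊗[k] L →+* K')
    (hgL : ∀ l, g (1 ⊗ₜ l) = algebraMap L K' l)
    (hg : ∀ z ∈ nonZeroDivisors (K ⊗[k] L), g z ≠ 0) (hdiv : ∀ z, ∃ a b, z = g a / g b) :
    cvg k K = cvg L K' := by
  letI : Algebra k K' := ((algebraMap L K').comp (algebraMap k L)).toAlgebra
  haveI : IsScalarTower k L K' := IsScalarTower.of_algebraMap_eq fun c => rfl
  letI : Algebra K K' := (g.comp (Algebra.TensorProduct.includeLeft : K →ₐ[k] K ⊗[k] L).toRingHom).toAlgebra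
  have hmap : ∀ a : K, algebraMap K K' a = g (a ⊗ₜ 1) := fun a => rfl
  haveI : IsScalarTower k K K' := IsScalarTower.of_algebraMap_eq fun c => by
    rw [hmap, IsScalarTower.algebraMap_apply k L K', ← hgL, Algebra.algebraMap_eq_smul_one,
      Algebra.algebraMap_eq_smul_one, TensorProduct.smul_tmul]
  obtain ⟨s, hs, hx⟩ := exists_fin_trbasis hK
  have hgen : IntermediateField.adjoin L (Set.range (algebraMap K K')) = ⊤ := gen_tensor g hgL hdiv
  have hind : AlgebraicIndependent L (algebraMap K K' ∘ ((↑) : s → K)) := indep_tensor g hgL hg _ hx.1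
  have hx' := trbasis_ext _ hx hind hgen
  have hK' : IsAlgFunctionField L K' := fg_ext hK hgen
  refine sInf_eq_of_dom _ _ ?_ ?_
  · rintro e ⟨he, hd⟩
    obtain ⟨M, _, _, f, B, t, hf, ht, hr⟩ := lemI e he hd
    obtain ⟨Ω, _, _, _, _⟩ := exists_closure L K'
    letI : Algebra L Ω := ((algebraMap K' Ω).comp (algebraMap L K')).toAlgebra
    haveI : IsScalarTower L K' Ω := IsScalarTower.of_algebraMap_eq fun c => rfl
    letI : Algebra k Ω := ((algebraMap K' Ω).comp (algebraMap k K')).toAlgebra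
    haveI : IsScalarTower k K' Ω := IsScalarTower.of_algebraMap_eq fun c => rfl
    have hw : WeakDiag L K' Ω e := lemC _ hx hx' hgen f hf B t ht e hr
    obtain ⟨e', h1, h2, h3⟩ := lemA hK' e hw
    exact ⟨e', ⟨h1, h3⟩, h2⟩
  · rintro e ⟨he, hd⟩
    obtain ⟨M, _, _, f, B, t, hf, ht, hr⟩ := lemI e he hd
    obtain ⟨Ω, _, _, _, _⟩ := exists_closure k K
    letI : Algebra k Ω := ((algebraMap K Ω).comp (algebraMap k K)).toAlgebra
    haveI : IsScalarTower k K Ω := IsScalarTower.of_algebraMap_eq fun c => rfl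
    letI : Algebra K' M := f.toRingHom.toAlgebra
    haveI : IsScalarTower L K' M := IsScalarTower.of_algebraMap_eq fun c => (f.commutes c).symm
    haveI : Algebra.IsIntegral K' M := ⟨hf⟩
    haveI : Algebra.IsAlgebraic K' M := inferInstance
    letI : Algebra K M := ((algebraMap K' M).comp (algebraMap K K')).toAlgebra
    haveI : IsScalarTower K K' M := IsScalarTower.of_algebraMap_eq fun c => rfl
    letI : Algebra k M := ((algebraMap L M).comp (algebraMap k L)).toAlgebra
    haveI : IsScalarTower k L M := IsScalarTower.of_algebraMap_eq fun c => rfl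
    haveI : IsScalarTower k K M := IsScalarTower.of_algebraMap_eq fun c => by
      rw [IsScalarTower.algebraMap_apply K K' M, ← IsScalarTower.algebraMap_apply k K K',
        IsScalarTower.algebraMap_apply k L K', ← IsScalarTower.algebraMap_apply L K' M,
        ← IsScalarTower.algebraMap_apply k L M]
    have hxM : IsTranscendenceBasis L (algebraMap K' M ∘ (algebraMap K K' ∘ ((↑) : s → K))) :=
      hx'.algebraMap_comp
    have hw : WeakDiag k K Ω e := lemD (L := L) _ hx hxM B t ht e hr
    obtain ⟨e', h1, h2, h3⟩ := lemA hK e hw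
    exact ⟨e', ⟨h1, h3⟩, h2⟩

end final

open scoped TensorProduct
attribute [local instance] Algebra.TensorProduct.rightAlgebra

/-- For any field extension `L/k` and any minimal prime `p` of `K ⊗_k L`, the fraction field
`K'` of `(K ⊗_k L)/p` satisfies `cvg_k(K) = cvg_L(K')`. -/
theorem stmt10 (k : Type u) (K : Type v) (L : Type w) [Field k] [Field K] [Field L]
    [Algebra k K] [Algebra k L] (hK : IsAlgFunctionField k K)
    (p : Ideal (K ⊗[k] L)) (hp : p ∈ minimalPrimes (K ⊗[k] L)) [p.IsPrime] :
    cvg k K = cvg L (FractionRing ((K ⊗[k] L) ⧸ p)) := by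
  refine cvg_core k K L _ hK
    ((algebraMap ((K ⊗[k] L) ⧸ p) (FractionRing ((K ⊗[k] L) ⧸ p))).comp (Ideal.Quotient.mk p)) ?_ ?_ ?_
  · intro l
    rfl
  · intro z hz h0
    have h1 : Ideal.Quotient.mk p z = 0 := (IsFractionRing.injective _ _) (h0.trans (map_zero _).symm)
    exact Set.disjoint_left.mp (Ideal.disjoint_nonZeroDivisors_of_mem_minimalPrimes hp)
      (Ideal.Quotient.eq_zero_iff_mem.mp h1) hz
  · intro z
    obtain ⟨a, b, -, rfl⟩ := IsFractionRing.div_surjective ((K ⊗[k] L) ⧸ p) z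
    obtain ⟨a, rfl⟩ := Ideal.Quotient.mk_surjective a
    obtain ⟨b, rfl⟩ := Ideal.Quotient.mk_surjective b
    exact ⟨a, b, rfl⟩
end

section
/- Let k be an algebraically closed field and let K be an algebraic function field over k of transcendence degree 1 (the function field of a smooth irreducible projective curve over k). Define the gonality gon_k(K) to be the least value of the degree [K : k(t)] over all elements t ∈ K transcendental over k, where k(t) denotes the intermediate subfield of K generated by t over k. Then cvg_k(K) = gon_k(K) and scvg_k(K) = gon_k(K). -/
universe u v

/-- The gonality of a function field `K` of transcendence degree 1 over `k`: the least degree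
`[K : k(t)]` over all `t ∈ K` transcendental over `k`. -/
noncomputable def gon (k : Type u) (K : Type v) [Field k] [Field K] [Algebra k K] : ℕ :=
  sInf {e : ℕ | ∃ t : K, Transcendental k t ∧
    Module.finrank ↥(IntermediateField.adjoin k {t}) K = e}

section aux

open Polynomial IntermediateField Module

/-- evaluation of polynomials at the generator of `k(x)`. -/
noncomputable def genHom (k : Type*) {A : Type*} [Field k] [Field A] [Algebra k A] (x : A) :
    k[X] →+* k⟮x⟯ := (aeval (AdjoinSimple.gen k x) : k[X] →ₐ[k] k⟮x⟯).toRingHom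

lemma algebraMap_genHom {k A : Type*} [Field k] [Field A] [Algebra k A] (x : A) (p : k[X]) :
    algebraMap k⟮x⟯ A (genHom k x p) = aeval x p := by
  have := (aeval_algebraMap_apply A (AdjoinSimple.gen k x) p)
  rw [AdjoinSimple.algebraMap_gen] at this
  exact this.symm

lemma genHom_injective {k A : Type*} [Field k] [Field A] [Algebra k A] {x : A}
    (hx : Transcendental k x) : Function.Injective (genHom k x) := by
  intro p q h
  have := congrArg (algebraMap k⟮x⟯ A) h
  rw [algebraMap_genHom, algebraMap_genHom] at this
  exact (transcendental_iff_injective.mp hx) this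

lemma exists_clear {k A : Type*} [Field k] [Field A] [Algebra k A] {x : A}
    (hx : Transcendental k x) (p : k⟮x⟯[X]) (hp : p ≠ 0) :
    ∃ h : k[X][X], h ≠ 0 ∧ (∃ a : k⟮x⟯, a ≠ 0 ∧ h.map (genHom k x) = C a * p) ∧
      ∀ q : k[X][X], p ∣ q.map (genHom k x) → h ∣ q := by
  classical
  let : Algebra k[X] k⟮x⟯ := (genHom k x).toAlgebra
  have hinj : Function.Injective (algebraMap k[X] k⟮x⟯) := genHom_injective hx
  have : FaithfulSMul k[X] k⟮x⟯ := (faithfulSMul_iff_algebraMap_injective _ _).mpr hinj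
  have : IsFractionRing k[X] k⟮x⟯ := by
    apply IsFractionRing.of_field
    intro z
    obtain ⟨r, s, hrs⟩ := (mem_adjoin_simple_iff k (z : A)).mp z.2
    refine ⟨r, s, ?_⟩
    apply (algebraMap k⟮x⟯ A).injective
    rw [map_div₀]
    change (z : A) = algebraMap k⟮x⟯ A (genHom k x r) / algebraMap k⟮x⟯ A (genHom k x s)
    rw [algebraMap_genHom, algebraMap_genHom, hrs]
  let : NormalizedGCDMonoid k[X] := Classical.choice inferInstance
  obtain ⟨b, hb, hb2⟩ := IsLocalization.integerNormalization_spec (nonZeroDivisors k[X]) p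
  set q0 := IsLocalization.integerNormalization (nonZeroDivisors k[X]) p with hq0
  have hb0 : b ≠ 0 := nonZeroDivisors.ne_zero hb
  have hq00 : q0 ≠ 0 := by
    rw [hq0, Ne, IsLocalization.integerNormalization_eq_zero_iff le_rfl]; exact hp
  have hc : q0.content ≠ 0 := by rwa [Ne, content_eq_zero_iff]
  have hc' : algebraMap k[X] k⟮x⟯ q0.content ≠ 0 := (map_ne_zero_iff _ hinj).mpr hc
  have hb' : algebraMap k[X] k⟮x⟯ b ≠ 0 := (map_ne_zero_iff _ hinj).mpr hb0
  have key : q0.primPart.map (algebraMap k[X] k⟮x⟯) =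
      C ((algebraMap k[X] k⟮x⟯ q0.content)⁻¹ * algebraMap k[X] k⟮x⟯ b) * p := by
    have h1 : (C q0.content * q0.primPart).map (algebraMap k[X] k⟮x⟯) = b • p := by
      rw [← eq_C_content_mul_primPart, hb2]
    rw [Polynomial.map_mul, map_C, ← IsScalarTower.algebraMap_smul k⟮x⟯ b p, smul_eq_C_mul] at h1
    rw [C_mul, mul_assoc, ← h1, ← mul_assoc, ← C_mul, inv_mul_cancel₀ hc', C_1, one_mul]
  refine ⟨q0.primPart, q0.primPart_ne_zero, ⟨_, mul_ne_zero (inv_ne_zero hc') hb', key⟩, ?_⟩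
  intro q hq
  apply q0.isPrimitive_primPart.dvd_of_fraction_map_dvd_fraction_map (K := k⟮x⟯)
  rw [key]
  obtain ⟨w, hw⟩ := hq
  set c := (algebraMap k[X] k⟮x⟯ q0.content)⁻¹ * algebraMap k[X] k⟮x⟯ b with hcdef
  have hc0 : c ≠ 0 := mul_ne_zero (inv_ne_zero hc') hb'
  refine ⟨C c⁻¹ * w, ?_⟩
  change q.map (genHom k x) = _
  rw [hw, show C c * p * (C c⁻¹ * w) = (C c * C c⁻¹) * (p * w) by ring, ← C_mul,
    mul_inv_cancel₀ hc0, C_1, one_mul]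

lemma aevalAeval_eq {k A : Type*} [Field k] [Field A] [Algebra k A] (x y : A) (p : k[X][X]) :
    aevalAeval x y p = eval₂ (algebraMap k⟮x⟯ A) y (p.map (genHom k x)) := by
  induction p using Polynomial.induction_on' with
  | add p q hp hq => rw [map_add, hp, hq, Polynomial.map_add, eval₂_add]
  | monomial n a =>
    rw [map_monomial, eval₂_monomial, algebraMap_genHom, ← C_mul_X_pow_eq_monomial, map_mul,
      map_pow, aevalAeval_C, aevalAeval_Y]

lemma coeff_coeff_swap {k : Type*} [Field k] (h : k[X][X]) (i j : ℕ) :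
    ((Bivariate.swap h).coeff i).coeff j = (h.coeff j).coeff i := by
  induction h using Polynomial.induction_on' with
  | add p q hp hq => simp only [map_add, coeff_add, hp, hq]
  | monomial n a =>
    induction a using Polynomial.induction_on' with
    | add p q hp hq => simp only [map_add, coeff_add, hp, hq]
    | monomial m r =>
      rw [Bivariate.swap_monomial_monomial]
      simp only [coeff_monomial]
      split_ifs <;> simp_all [coeff_monomial]

lemma coeff_natDegree_le_swap {k : Type*} [Field k] (h : k[X][X]) (j : ℕ) :
    (h.coeff j).natDegree ≤ (Bivariate.swap h).natDegree := by
  rw [natDegree_le_iff_coeff_eq_zero]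
  intro i hi
  rw [← coeff_coeff_swap, coeff_eq_zero_of_natDegree_lt hi, coeff_zero]

lemma natDegree_map_genHom {k A : Type*} [Field k] [Field A] [Algebra k A] {x : A}
    (hx : Transcendental k x) (h : k[X][X]) : (h.map (genHom k x)).natDegree = h.natDegree :=
  natDegree_map_eq_of_injective (genHom_injective hx) h

/-- the relation between the degrees -/
lemma norm_degree {k K M : Type*} [Field k] [Field K] [Field M] [Algebra k K] [Algebra K M]
    [Algebra k M] [IsScalarTower k K M] [FiniteDimensional K M] (u : M) (hu : Transcendental k u)
    (s : K) (hsu : s = Algebra.norm K u) (hs : Transcendental k s)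
    [FiniteDimensional k⟮u⟯ M] : finrank k⟮s⟯ K ≤ finrank k⟮u⟯ M := by
  by_cases hfin : FiniteDimensional k⟮s⟯ K
  swap
  · rw [finrank_of_not_finite hfin]; exact Nat.zero_le _
  have hfM : FiniteDimensional k⟮s⟯ M := FiniteDimensional.trans k⟮s⟯ K M
  have hui : IsIntegral k⟮s⟯ u := Algebra.IsIntegral.isIntegral u
  set s' : M := algebraMap K M s with hs'
  have hsi : IsIntegral k⟮u⟯ s' := Algebra.IsIntegral.isIntegral s'
  -- degrees over the compositum
  have hr : finrank k⟮s⟯⟮u⟯ M = finrank k⟮u⟯⟮s'⟯ M := by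
    have : k⟮s⟯⟮u⟯.toSubfield = k⟮u⟯⟮s'⟯.toSubfield := by
      apply le_antisymm
      · change Subfield.closure _ ≤ _
        rw [Subfield.closure_le]
        rintro z (⟨y, rfl⟩ | rfl)
        · have hy : y.1 ∈ Subfield.closure (Set.range (algebraMap k K) ∪ {s}) := y.2
          change algebraMap K M y.1 ∈ k⟮u⟯⟮s'⟯.toSubfield
          have : Subfield.closure (Set.range (algebraMap k K) ∪ {s}) ≤
              (k⟮u⟯⟮s'⟯.toSubfield).comap (algebraMap K M) := by
            rw [Subfield.closure_le]
            rintro w (⟨c, rfl⟩ | rfl)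
            · change algebraMap K M (algebraMap k K c) ∈ k⟮u⟯⟮s'⟯
              rw [← IsScalarTower.algebraMap_apply, IsScalarTower.algebraMap_apply k k⟮u⟯ M]
              exact IntermediateField.algebraMap_mem _ _
            · exact mem_adjoin_simple_self k⟮u⟯ s'
          exact this hy
        · have : z = algebraMap k⟮z⟯ M (AdjoinSimple.gen k z) := rfl
          change z ∈ k⟮z⟯⟮s'⟯
          rw [this]
          exact IntermediateField.algebraMap_mem _ _
      · change Subfield.closure _ ≤ _
        rw [Subfield.closure_le]
        rintro z (⟨y, rfl⟩ | rfl)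
        · have hy : y.1 ∈ Subfield.closure (Set.range (algebraMap k M) ∪ {u}) := y.2
          change y.1 ∈ k⟮s⟯⟮u⟯.toSubfield
          have : Subfield.closure (Set.range (algebraMap k M) ∪ {u}) ≤
              (k⟮s⟯⟮u⟯.toSubfield) := by
            rw [Subfield.closure_le]
            rintro w (⟨c, rfl⟩ | rfl)
            · change algebraMap k M c ∈ k⟮s⟯⟮u⟯
              rw [IsScalarTower.algebraMap_apply k k⟮s⟯ M]
              exact IntermediateField.algebraMap_mem _ _
            · exact mem_adjoin_simple_self k⟮s⟯ w
          exact this hy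
        · change s' ∈ k⟮s⟯⟮u⟯
          have : s' = algebraMap k⟮s⟯ M (AdjoinSimple.gen k s) := rfl
          rw [this]
          exact IntermediateField.algebraMap_mem _ _
    change finrank k⟮s⟯⟮u⟯.toSubfield M = finrank k⟮u⟯⟮s'⟯.toSubfield M
    rw [this]
  set r := finrank k⟮u⟯⟮s'⟯ M with hrdef
  have he : finrank k⟮u⟯ M = (minpoly k⟮u⟯ s').natDegree * r := by
    rw [← adjoin.finrank hsi, hrdef, finrank_mul_finrank]
  have hrpos : 0 < r := finrank_pos
  -- norm relation
  have hnorm : (AdjoinSimple.gen k s) ^ finrank k⟮s⟯ K =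
      ((-1) ^ (minpoly k⟮s⟯ u).natDegree * (minpoly k⟮s⟯ u).coeff 0) ^ r := by
    have h1 : Algebra.norm k⟮s⟯ u = (AdjoinSimple.gen k s) ^ finrank k⟮s⟯ K := by
      rw [← Algebra.norm_norm (S := K), ← hsu, ← Algebra.norm_algebraMap]
      rfl
    have h2 : Algebra.norm k⟮s⟯ u =
      ((-1) ^ (minpoly k⟮s⟯ u).natDegree * (minpoly k⟮s⟯ u).coeff 0) ^ r := by
      rw [← Algebra.norm_norm (S := k⟮s⟯⟮u⟯), ← hr]
      have h3 : Algebra.norm k⟮s⟯⟮u⟯ u = (AdjoinSimple.gen k⟮s⟯ u) ^ finrank k⟮s⟯⟮u⟯ M := by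
        rw [← Algebra.norm_algebraMap]; rfl
      rw [h3, map_pow]
      have h4 := Algebra.PowerBasis.norm_gen_eq_coeff_zero_minpoly (adjoin.powerBasis hui)
      rw [adjoin.powerBasis_gen, adjoin.powerBasis_dim, minpoly_gen] at h4
      rw [h4]
    rw [← h1, h2]
  obtain ⟨h, hh0, ⟨a, ha, hmap⟩, hdvd⟩ := exists_clear hs (minpoly k⟮s⟯ u) (minpoly.ne_zero hui)
  obtain ⟨q, hq0, ⟨b, hb, hqmap⟩, -⟩ := exists_clear hu (minpoly k⟮u⟯ s') (minpoly.ne_zero hsi)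
  have hqdeg : q.natDegree = (minpoly k⟮u⟯ s').natDegree := by
    rw [← natDegree_map_genHom hu, hqmap, natDegree_C_mul hb]
  have hqe : aevalAeval s' u (Bivariate.swap q) = 0 := by
    rw [Bivariate.aevalAeval_swap, aevalAeval_eq, hqmap, eval₂_mul]
    have := minpoly.aeval k⟮u⟯ s'
    rw [aeval_def] at this
    rw [this, mul_zero]
  have hhq : h ∣ Bivariate.swap q := by
    apply hdvd
    apply minpoly.dvd
    rw [aevalAeval_eq, eval₂_map] at hqe
    rw [aeval_def, eval₂_map]
    have hring : (algebraMap k⟮s⟯ M).comp (genHom k s) =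
        (algebraMap k⟮s'⟯ M).comp (genHom k s') := by
      refine RingHom.ext fun p => ?_
      rw [RingHom.comp_apply, RingHom.comp_apply, algebraMap_genHom,
        IsScalarTower.algebraMap_apply k⟮s⟯ K M, algebraMap_genHom, hs', aeval_algebraMap_apply]
    rw [hring, hqe]
  have hhq' : Bivariate.swap h ∣ q := by
    have := map_dvd (Bivariate.swap (R := k)) hhq
    rwa [Bivariate.swap_swap_apply] at this
  have hdeg : (h.coeff 0).natDegree ≤ (minpoly k⟮u⟯ s').natDegree :=
    (coeff_natDegree_le_swap h 0).trans (hqdeg ▸ natDegree_le_of_dvd hhq' hq0)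
  have hlead : genHom k s h.leadingCoeff = a := by
    have h1 : (h.map (genHom k s)).leadingCoeff = a := by
      rw [hmap, leadingCoeff_mul, leadingCoeff_C, minpoly.monic hui, mul_one]
    rwa [leadingCoeff_map_of_injective (genHom_injective hs)] at h1
  have hc0 : genHom k s (h.coeff 0) = a * (minpoly k⟮s⟯ u).coeff 0 := by
    rw [← coeff_map, hmap, coeff_C_mul]
  have hX : genHom k s X = AdjoinSimple.gen k s := by simp [genHom]
  have hpoly : h.leadingCoeff ^ r * X ^ finrank k⟮s⟯ K =
      (((-1) ^ (minpoly k⟮s⟯ u).natDegree) * h.coeff 0) ^ r := by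
    apply genHom_injective hs
    simp only [map_mul, map_pow, map_neg, map_one, hlead, hc0, hX, hnorm]
    ring
  have hd := congrArg natDegree hpoly
  rw [natDegree_mul (pow_ne_zero _ (leadingCoeff_ne_zero.mpr hh0)) (pow_ne_zero _ X_ne_zero),
    natDegree_X_pow, natDegree_pow, natDegree_pow] at hd
  have hd2 : ((-1) ^ (minpoly k⟮s⟯ u).natDegree * h.coeff 0).natDegree = (h.coeff 0).natDegree := by
    rcases neg_one_pow_eq_or k[X] (minpoly k⟮s⟯ u).natDegree with h | h <;> simp [h]
  rw [hd2] at hd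
  rw [he]
  nlinarith

lemma exists_norm {k K M : Type*} [Field k] [IsAlgClosed k] [Field K] [Field M] [Algebra k K]
    [Algebra K M] [Algebra k M] [IsScalarTower k K M] [FiniteDimensional K M] (t : M)
    (ht : Transcendental k t) :
    ∃ c : k, Algebra.norm K (algebraMap k M c - t) / Algebra.norm K (-t) ∉
      Set.range (algebraMap k K) := by
  classical
  by_contra! hcon
  have ht0 : t ≠ 0 := by rintro rfl; exact ht isAlgebraic_zero
  choose g hg using hcon
  set F := (Algebra.lmul K M t).charpoly with hF
  have hFm : F.Monic := LinearMap.charpoly_monic _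
  have hev : ∀ c : k, F.eval (algebraMap k K c) = Algebra.norm K (algebraMap k M c - t) := by
    intro c
    rw [hF, LinearMap.eval_charpoly, Algebra.norm_apply,
      IsScalarTower.algebraMap_apply k K M, map_sub (Algebra.lmul K M), AlgHom.commutes]
  set N := Algebra.norm K (-t) with hN
  have hN0 : N ≠ 0 := by
    rw [hN, Algebra.norm_ne_zero_iff]; exact neg_ne_zero.mpr ht0
  have hCH : aeval t F = 0 := by
    have h1 := LinearMap.aeval_self_charpoly (Algebra.lmul K M t)
    rw [aeval_algHom_apply, ← hF] at h1
    have := congrArg (fun f : Module.End K M => f 1) h1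
    simpa using this
  have : Infinite k := IsAlgClosed.instInfinite
  obtain ⟨S, hS⟩ := Infinite.exists_subset_card_eq k (F.natDegree + 1)
  set P := Lagrange.interpolate S id g with hP
  have hPd : P.degree < S.card := Lagrange.degree_interpolate_lt _ Function.injective_id.injOn
  have hFP : F = C N * P.map (algebraMap k K) := by
    apply Polynomial.eq_of_degrees_lt_of_eval_index_eq (v := algebraMap k K) S
      (algebraMap k K).injective.injOn
    · rw [hS]
      exact lt_of_le_of_lt degree_le_natDegree (by exact_mod_cast Nat.lt_succ_self _)
    · rw [degree_C_mul hN0, degree_map]; exact hPd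
    · intro c hc
      have : P.eval c = g c :=
        Lagrange.eval_interpolate_at_node (v := id) _ Function.injective_id.injOn hc
      rw [hev, eval_mul, eval_C, eval_map_apply, this, hg, mul_div_cancel₀ _ hN0]
  apply ht
  refine ⟨P, ?_, ?_⟩
  · intro h0
    rw [h0, Polynomial.map_zero, mul_zero] at hFP
    exact hFm.ne_zero hFP
  · rw [hFP, map_mul, aeval_C, aeval_map_algebraMap] at hCH
    exact (mul_eq_zero.mp hCH).resolve_left ((_root_.map_ne_zero _).mpr hN0)

lemma transcendental_of_not_mem {k A : Type*} [Field k] [IsAlgClosed k] [Field A] [Algebra k A]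
    {x : A} (hx : x ∉ Set.range (algebraMap k A)) : Transcendental k x := by
  intro h
  apply hx
  have : Algebra.IsAlgebraic k k⟮x⟯ := isAlgebraic_adjoin_simple h.isIntegral
  obtain ⟨y, hy⟩ := (IsAlgClosed.algebraMap_bijective_of_isIntegral (k := k) (K := k⟮x⟯)).2
    (AdjoinSimple.gen k x)
  exact ⟨y, congrArg (algebraMap k⟮x⟯ A) hy⟩

lemma exists_le {k K M : Type*} [Field k] [IsAlgClosed k] [Field K] [Field M] [Algebra k K]
    [Algebra K M] [Algebra k M] [IsScalarTower k K M] [FiniteDimensional K M] (t : M)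
    (ht : Transcendental k t) [FiniteDimensional k⟮t⟯ M] :
    ∃ s : K, Transcendental k s ∧ finrank k⟮s⟯ K ≤ finrank k⟮t⟯ M := by
  obtain ⟨c, hc⟩ := exists_norm (K := K) t ht
  have ht0 : t ≠ 0 := by rintro rfl; exact ht isAlgebraic_zero
  have hc0 : c ≠ 0 := by
    rintro rfl
    apply hc
    refine ⟨1, ?_⟩
    rw [map_zero, zero_sub, map_one, div_self]
    rw [Algebra.norm_ne_zero_iff]; exact neg_ne_zero.mpr ht0
  set u : M := (algebraMap k M c - t) / (-t) with hu
  have hnu : Algebra.norm K u ∉ Set.range (algebraMap k K) := by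
    rwa [hu, div_eq_mul_inv, map_mul, Algebra.norm_inv, ← div_eq_mul_inv]
  have hut : Transcendental k u := by
    apply transcendental_of_not_mem
    rintro ⟨a, ha⟩
    apply hnu
    rw [← ha, IsScalarTower.algebraMap_apply k K M, Algebra.norm_algebraMap]
    exact ⟨a ^ _, map_pow _ _ _⟩
  have hcM : algebraMap k M c ≠ 0 := (_root_.map_ne_zero _).mpr hc0
  have hkt : k⟮u⟯ = k⟮t⟯ := by
    apply le_antisymm
    · rw [adjoin_simple_le_iff]
      have := mem_adjoin_simple_self k t
      exact div_mem (sub_mem (IntermediateField.algebraMap_mem _ _) this) (neg_mem this)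
    · rw [adjoin_simple_le_iff]
      have h1 := mem_adjoin_simple_self k u
      have h2 : t = algebraMap k M c / (1 - u) := by
        have : 1 - u = algebraMap k M c / t := by rw [hu]; field_simp; ring
        rw [this]; field_simp
      rw [h2]
      exact div_mem (IntermediateField.algebraMap_mem _ _) (sub_mem (one_mem _) h1)
  have : FiniteDimensional k⟮u⟯ M := by rw [hkt]; infer_instance
  refine ⟨Algebra.norm K u, transcendental_of_not_mem hnu, ?_⟩
  rw [← hkt]
  exact norm_degree u hut _ rfl (transcendental_of_not_mem hnu)

lemma trdeg_le_one {k K : Type*} [Field k] [Field K] [Algebra k K] {t : K}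
    (h : Algebra.IsAlgebraic k⟮t⟯ K) : Algebra.trdeg k K ≤ 1 := by
  rw [IntermediateField.isAlgebraic_adjoin_iff_top] at h
  have := Algebra.IsAlgebraic.trdeg_le_cardinalMk k {t}
  simpa using this

lemma isAlgebraic_of_trdeg {k K : Type*} [Field k] [Field K] [Algebra k K] {t : K}
    (h : Algebra.trdeg k K ≤ 1) (ht : Transcendental k t) : Algebra.IsAlgebraic k⟮t⟯ K := by
  have h1 : AlgebraicIndependent k ![t] := algebraicIndependent_iff_transcendental.mpr ht
  have h2 := (h1.isTranscendenceBasis_of_lift_trdeg_le_of_finite (by simpa using h)).isAlgebraic_field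
  rwa [Matrix.range_cons, Matrix.range_empty, Set.union_empty] at h2

lemma finrank_ratFunc {k B M : Type*} [Field k] [Field B] [Field M] [Algebra k B] [Algebra k M]
    (hB : Function.Surjective (algebraMap k B)) (π : RatFunc B →ₐ[k] M) :
    (letI := π.toRingHom.toAlgebra
     finrank (RatFunc B) M) = finrank k⟮π RatFunc.X⟯ M := by
  have hr : π.fieldRange = k⟮π RatFunc.X⟯ := by
    apply le_antisymm
    · rintro _ ⟨r, rfl⟩
      have hp : ∀ p : B[X], π (algebraMap B[X] (RatFunc B) p) ∈ k⟮π RatFunc.X⟯ := by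
        intro p
        induction p using Polynomial.induction_on' with
        | add p q hp hq => rw [map_add, map_add]; exact add_mem hp hq
        | monomial n b =>
          obtain ⟨a, rfl⟩ := hB b
          rw [← C_mul_X_pow_eq_monomial, map_mul, map_mul, map_pow, map_pow, RatFunc.algebraMap_X]
          refine mul_mem ?_ (pow_mem (mem_adjoin_simple_self k _) _)
          have : algebraMap B[X] (RatFunc B) (C (algebraMap k B a)) = algebraMap k (RatFunc B) a := by
            rw [IsScalarTower.algebraMap_apply k B[X] (RatFunc B)]; rfl
          rw [this, AlgHom.commutes]
          exact IntermediateField.algebraMap_mem _ _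
      change π r ∈ _
      rw [← RatFunc.num_div_denom r, map_div₀]
      exact div_mem (hp _) (hp _)
    · rw [adjoin_simple_le_iff]
      exact ⟨_, rfl⟩
  rw [← hr]
  let := π.toRingHom.toAlgebra
  exact Algebra.finrank_eq_of_equiv_equiv (AlgEquiv.ofInjectiveField π).toRingEquiv
    (RingEquiv.refl M) rfl

lemma diagram_bound (k : Type u) (K : Type v) [Field k] [IsAlgClosed k] [Field K] [Algebra k K]
    (htr : Algebra.trdeg k K ≤ 1) (e : ℕ) (he : 0 < e) (h : HasCvgDiagram k K e) :
    ∃ s : K, Transcendental k s ∧ finrank k⟮s⟯ K ≤ e := by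
  obtain ⟨B, M, _, _, _, _, -, -, f, π, hf, hπ⟩ := h
  let := f.toRingHom.toAlgebra
  have : IsScalarTower k K M := IsScalarTower.of_algebraMap_eq fun x => (f.commutes x).symm
  have hfin : FiniteDimensional K M := hf
  have hM : Algebra.trdeg k M ≤ 1 := by
    have h1 := lift_trdeg_add_eq k K M
    rw [trdeg_eq_zero (R := K) (A := M), Cardinal.lift_zero, add_zero] at h1
    have h2 : Cardinal.lift.{v} (Algebra.trdeg k M) ≤ 1 := by
      rw [← h1]; simpa using htr
    simpa using h2
  have hRB : Algebra.trdeg k (RatFunc B) ≤ 1 :=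
    (trdeg_le_of_injective π π.toRingHom.injective).trans hM
  have hB0 : Algebra.trdeg k B = 0 := by
    have h1 := trdeg_add_eq k B (A := RatFunc B)
    have h2 : 1 ≤ Algebra.trdeg B (RatFunc B) :=
      Cardinal.one_le_iff_pos.mpr (trdeg_pos _ _)
    by_contra h0
    have h3 : 1 ≤ Algebra.trdeg k B := Cardinal.one_le_iff_ne_zero.mpr h0
    have h4 : (1 : Cardinal) + 1 ≤ 1 := (add_le_add h3 h2).trans (h1.le.trans hRB)
    norm_num at h4
  have : Algebra.IsAlgebraic k B := trdeg_eq_zero_iff.mp hB0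
  have hB : Function.Surjective (algebraMap k B) :=
    (IsAlgClosed.algebraMap_bijective_of_isIntegral (k := k) (K := B)).2
  have hrank := finrank_ratFunc hB π
  rw [hπ] at hrank
  have ht : Transcendental k (π RatFunc.X) := by
    intro hal
    rw [isAlgebraic_algHom_iff π π.toRingHom.injective] at hal
    exact RatFunc.transcendental_X (K := B) (hal.tower_top B)
  have : FiniteDimensional k⟮π RatFunc.X⟯ M := by
    apply FiniteDimensional.of_finrank_pos
    rw [← hrank]; exact he
  obtain ⟨s, hs, hle⟩ := exists_le (K := K) (π RatFunc.X) ht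
  exact ⟨s, hs, hle.trans hrank.ge⟩

lemma fg_of_algEquiv {k A B : Type*} [Field k] [Field A] [Field B] [Algebra k A] [Algebra k B]
    (f : A ≃ₐ[k] B) (h : IsAlgFunctionField k A) : IsAlgFunctionField k B := by
  unfold IsAlgFunctionField at *
  rw [IntermediateField.fg_top_iff] at *
  let := f.toAlgHom.toRingHom.toAlgebra
  have : IsScalarTower k A B := IsScalarTower.of_algebraMap_eq fun x => (f.commutes x).symm
  have : Module.Finite A B := RingHom.Finite.of_surjective f.toAlgHom.toRingHom f.surjective
  exact Algebra.EssFiniteType.comp k A B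

lemma sepDiagram (k : Type u) (K : Type v) [Field k] [Field K] [Algebra k K]
    (hK : IsAlgFunctionField k K) (t : K) (ht : Transcendental k t) :
    HasSepCvgDiagram k K (finrank k⟮t⟯ K) := by
  let φ : (ULift.{v} k)[X] →ₐ[k] K :=
    (aeval t).comp (mapAlgHom (ULift.algEquiv (R := k) (A := k)).toAlgHom)
  have hφ : Function.Injective φ := by
    refine (transcendental_iff_injective.mp ht).comp ?_
    exact Polynomial.map_injective _ (ULift.algEquiv (R := k) (A := k)).injective
  let τ : RatFunc (ULift.{v} k) →ₐ[k] K :=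
    RatFunc.liftAlgHom φ (nonZeroDivisors_le_comap_nonZeroDivisors_of_injective _ hφ)
  have hτ : τ RatFunc.X = t := by
    change RatFunc.liftAlgHom φ _ RatFunc.X = t
    rw [RatFunc.liftAlgHom_apply, RatFunc.num_X, RatFunc.denom_X]
    simp [φ]
  have hsurj : Function.Surjective (algebraMap k (ULift.{v} k)) := fun x => ⟨x.down, rfl⟩
  have hr := finrank_ratFunc hsurj τ
  rw [hτ] at hr
  let f : K ≃ₐ[k] ULift.{u} K := ULift.algEquiv.symm
  refine ⟨ULift.{v} k, ULift.{u} K, inferInstance, inferInstance, inferInstance, inferInstance,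
    ?_, fg_of_algEquiv f hK, f.toAlgHom, f.toAlgHom.comp τ, ?_, ?_, ?_⟩
  · apply fg_of_algEquiv (ULift.algEquiv (R := k) (A := k)).symm
    unfold IsAlgFunctionField
    rw [IntermediateField.fg_top_iff]
    infer_instance
  · exact RingHom.Finite.of_surjective _ f.surjective
  · let := f.toAlgHom.toRingHom.toAlgebra
    refine ⟨fun x => ?_⟩
    obtain ⟨y, rfl⟩ := f.surjective x
    exact isSeparable_algebraMap y
  · rw [← hr]
    let i1 := τ.toRingHom.toAlgebra
    let i2 := (f.toAlgHom.comp τ).toRingHom.toAlgebra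
    symm
    exact Algebra.finrank_eq_of_equiv_equiv (RingEquiv.refl _) f.toRingEquiv rfl

end aux

open IntermediateField Module

/-- For the function field `K` of a smooth irreducible projective curve over an algebraically
closed field `k` (i.e. a function field of transcendence degree `1`), both the covering
gonality and the separable covering gonality equal the gonality. -/
theorem stmt14 (k : Type u) (K : Type v) [Field k] [IsAlgClosed k] [Field K] [Algebra k K]
    (hK : IsAlgFunctionField k K)
    (htr : ∃ t : K, Transcendental k t ∧
      Algebra.IsAlgebraic ↥(IntermediateField.adjoin k {t}) K) :
    cvg k K = gon k K ∧ scvg k K = gon k K := by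
  obtain ⟨t0, ht0, halg⟩ := htr
  have htd := trdeg_le_one halg
  have hsc : ∀ e, HasSepCvgDiagram k K e → HasCvgDiagram k K e := by
    rintro e ⟨B, C, i1, i2, i3, i4, h1, h2, f, π, h3, -, h5⟩
    exact ⟨B, C, i1, i2, i3, i4, h1, h2, f, π, h3, h5⟩
  have hpos : ∀ t : K, Transcendental k t → 0 < finrank k⟮t⟯ K := by
    intro t ht
    have := isAlgebraic_of_trdeg htd ht
    have h1 : Algebra.EssFiniteType k K := IntermediateField.fg_top_iff.mp hK
    have h2 : Algebra.EssFiniteType k⟮t⟯ K := Algebra.EssFiniteType.of_comp k _ _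
    have : FiniteDimensional k⟮t⟯ K := Algebra.finite_of_essFiniteType_of_isAlgebraic
    exact finrank_pos
  have hne : {e : ℕ | ∃ t : K, Transcendental k t ∧ finrank k⟮t⟯ K = e}.Nonempty :=
    ⟨_, t0, ht0, rfl⟩
  obtain ⟨t1, ht1, hg⟩ := Nat.sInf_mem hne
  change _ = gon k K at hg
  have hlow : ∀ e, 0 < e → HasCvgDiagram k K e → gon k K ≤ e := by
    intro e he h
    obtain ⟨s, hs, hle⟩ := diagram_bound k K htd e he h
    have h1 : gon k K ≤ finrank k⟮s⟯ K := Nat.sInf_le ⟨s, hs, rfl⟩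
    exact h1.trans hle
  have hs := sepDiagram k K hK t1 ht1
  have hp := hpos t1 ht1
  rw [hg] at hs hp
  constructor
  · apply le_antisymm
    · exact Nat.sInf_le ⟨hp, hsc _ hs⟩
    · obtain ⟨h1, h2⟩ := Nat.sInf_mem (s := {e : ℕ | 0 < e ∧ HasCvgDiagram k K e})
        ⟨_, hp, hsc _ hs⟩
      exact hlow _ h1 h2
  · apply le_antisymm
    · exact Nat.sInf_le ⟨hp, hs⟩
    · obtain ⟨h1, h2⟩ := Nat.sInf_mem (s := {e : ℕ | 0 < e ∧ HasSepCvgDiagram k K e})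
        ⟨_, hp, hs⟩
      exact hlow _ h1 (hsc _ h2)
end
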